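/- arXiv:1307.0047 — 2 statements merged into one kernel-verified Lean document; each statement's English description precedes it below -/
import Mathlib

section
/- Let n ≥ 5, a ≥ 0 and p > (n+4+2a)/(n-4) with p·ℓ₁ > n(n-4)/2 and p·ℓ₂ > n²(n-4)²/16. Suppose u is a C⁴ solution of Δ²u = |x|^a |u|^{p-1} u on ℝ^n \ {0} that is stable on ℝ^n \ {0} and homogeneous of degree −β, i.e. u(τx) = τ^{−β} u(x) for all τ > 0 and all x ≠ 0. Then u ≡ 0. -/
open MeasureTheory Metric Set Filter
open scoped RealInnerProductSpace Topology

noncomputable section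

/-- The Laplacian of `u : ℝⁿ → ℝ` at `x`, as the sum of the pure second
partial derivatives in the coordinate directions. -/
def lap (n : ℕ) (u : EuclideanSpace ℝ (Fin n) → ℝ) (x : EuclideanSpace ℝ (Fin n)) : ℝ :=
  ∑ i : Fin n, iteratedFDeriv ℝ 2 u x ![EuclideanSpace.single i 1, EuclideanSpace.single i 1]

/-- `u` solves `Δ²u = |x|^a |u|^(p-1) u` pointwise on `Ω`. -/
def IsSolutionOn (n : ℕ) (a p : ℝ) (u : EuclideanSpace ℝ (Fin n) → ℝ)
    (Ω : Set (EuclideanSpace ℝ (Fin n))) : Prop :=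
  ∀ x ∈ Ω, lap n (lap n u) x = ‖x‖ ^ a * |u x| ^ (p - 1) * u x

/-- `u` is a stable solution on `Ω`:
`p ∫ |x|^a |u|^(p-1) ψ² ≤ ∫ (Δψ)²` for every test function `ψ ∈ C_c^∞(Ω)`. -/
def StableOn (n : ℕ) (a p : ℝ) (u : EuclideanSpace ℝ (Fin n) → ℝ)
    (Ω : Set (EuclideanSpace ℝ (Fin n))) : Prop :=
  ∀ ψ : EuclideanSpace ℝ (Fin n) → ℝ, ContDiff ℝ (⊤ : ℕ∞) ψ → HasCompactSupport ψ →
    tsupport ψ ⊆ Ω →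
    p * ∫ x, ‖x‖ ^ a * |u x| ^ (p - 1) * ψ x ^ 2 ≤ ∫ x, lap n ψ x ^ 2

/-- Surface integral of `f` over the sphere `∂B_r(x)`, with respect to the
`(n-1)`-dimensional Hausdorff measure. -/
def sphInt (n : ℕ) (x : EuclideanSpace ℝ (Fin n)) (r : ℝ)
    (f : EuclideanSpace ℝ (Fin n) → ℝ) : ℝ :=
  ∫ y in sphere x r, f y ∂(Measure.hausdorffMeasure ((n : ℝ) - 1))

/-- Radial derivative of `u` at `y`, relative to the center `x`. -/
def radDeriv (n : ℕ) (x : EuclideanSpace ℝ (Fin n))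
    (u : EuclideanSpace ℝ (Fin n) → ℝ) (y : EuclideanSpace ℝ (Fin n)) : ℝ :=
  ⟪gradient u y, ‖y - x‖⁻¹ • (y - x)⟫

/-- `ℓ₁ = (β+2)(n-4-β) + β(n-2-β)` with `β = (4+a)/(p-1)`. -/
def ell1 (n : ℕ) (a p : ℝ) : ℝ :=
  let β : ℝ := (4 + a) / (p - 1)
  (β + 2) * ((n : ℝ) - 4 - β) + β * ((n : ℝ) - 2 - β)

/-- `ℓ₂ = β(β+2)(n-4-β)(n-2-β)` with `β = (4+a)/(p-1)`. -/
def ell2 (n : ℕ) (a p : ℝ) : ℝ :=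
  let β : ℝ := (4 + a) / (p - 1)
  β * (β + 2) * ((n : ℝ) - 4 - β) * ((n : ℝ) - 2 - β)

/-- The constant `c(n,p,a) = 2(ρ - γ - 1)`, `ρ = n-1-2β`, `γ = β(β-n+2)`. -/
def cConst (n : ℕ) (a p : ℝ) : ℝ :=
  let β : ℝ := (4 + a) / (p - 1)
  2 * (((n : ℝ) - 1 - 2 * β) - β * (β - (n : ℝ) + 2) - 1)

/-- The rescaled energy `E(r; x, u)` from the monotonicity formula. -/
def energyE (n : ℕ) (a p : ℝ) (u : EuclideanSpace ℝ (Fin n) → ℝ)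
    (x : EuclideanSpace ℝ (Fin n)) (r : ℝ) : ℝ :=
  let β : ℝ := (4 + a) / (p - 1)
  r ^ (2 * β + 4 - (n : ℝ)) *
      (∫ y in ball x r,
        (1 / 2) * lap n u y ^ 2 - (1 / (p + 1)) * ‖y‖ ^ a * |u y| ^ (p + 1))
    + β / 2 * ((n : ℝ) - 2 - β) *
        deriv (fun ρ : ℝ => ρ ^ (2 * β + 1 - (n : ℝ)) * sphInt n x ρ fun y => u y ^ 2) r
    + β / 2 * ((n : ℝ) - 2 - β) *
        deriv (fun ρ : ℝ => ρ ^ (2 * β + 2 - (n : ℝ)) * sphInt n x ρ fun y => u y ^ 2) r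
    + r ^ 3 / 2 *
        deriv (fun ρ : ℝ => ρ ^ (2 * β + 1 - (n : ℝ)) *
          sphInt n x ρ fun y => (β * ρ⁻¹ * u y + radDeriv n x u y) ^ 2) r
    + 1 / 2 *
        deriv (fun ρ : ℝ => ρ ^ (2 * β + 4 - (n : ℝ)) *
          sphInt n x ρ fun y => ‖gradient u y‖ ^ 2 - radDeriv n x u y ^ 2) r
    + 1 / 2 * r ^ (2 * β + 3 - (n : ℝ)) *
        (sphInt n x r fun y => ‖gradient u y‖ ^ 2 - radDeriv n x u y ^ 2)

end

section Calculus

variable {n : ℕ}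

local notation "𝔼" => EuclideanSpace ℝ (Fin n)

/-- Homogeneity of degree zero away from the origin. -/
def DegZero (g : 𝔼 → ℝ) : Prop :=
  ∀ τ : ℝ, 0 < τ → ∀ x : 𝔼, x ≠ 0 → g (τ • x) = g x

lemma lap_congr {f g : 𝔼 → ℝ} {x : 𝔼} (h : f =ᶠ[𝓝 x] g) : lap n f x = lap n g x := by
  simp only [lap, (h.iteratedFDeriv ℝ 2).eq_of_nhds]

lemma lap_eq_sum {f : 𝔼 → ℝ} {x : 𝔼} (hf : ContDiffAt ℝ 2 f x) :
    lap n f x = ∑ i : Fin n, fderiv ℝ (fun y => fderiv ℝ f y (EuclideanSpace.single i 1)) x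
      (EuclideanSpace.single i 1) := by
  have h : DifferentiableAt ℝ (fderiv ℝ f) x :=
    (hf.fderiv_right (m := 1) (by norm_num)).differentiableAt (by norm_num)
  unfold lap
  refine Finset.sum_congr rfl fun i _ => ?_
  rw [iteratedFDeriv_two_apply, fderiv_clm_apply h (by fun_prop)]
  simp

lemma contDiffAt_lap {f : 𝔼 → ℝ} {x : 𝔼} {k m : ℕ} (hf : ContDiffAt ℝ m f x) (h : k + 2 ≤ m) :
    ContDiffAt ℝ k (lap n f) x := by
  have h1 : ContDiffAt ℝ k (iteratedFDeriv ℝ 2 f) x :=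
    hf.iteratedFDeriv_right (by exact_mod_cast h)
  unfold lap
  refine ContDiffAt.sum fun i _ => ?_
  exact (ContinuousMultilinearMap.apply ℝ (fun _ : Fin 2 => 𝔼) ℝ
    ![EuclideanSpace.single i 1, EuclideanSpace.single i 1]).contDiff.contDiffAt.comp x h1

lemma lap_sub_const_mul {f g : 𝔼 → ℝ} {x : 𝔼} (c : ℝ) (hf : ContDiffAt ℝ 2 f x)
    (hg : ContDiffAt ℝ 2 g x) :
    lap n (fun y => f y - c * g y) x = lap n f x - c * lap n g x := by
  have h1 := InnerProductSpace.laplacian_eq_iteratedFDeriv_orthonormalBasis (E := 𝔼) (F := ℝ)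
  have h2 (f : 𝔼 → ℝ) : lap n f = Laplacian.laplacian f := by
    rw [h1 f (EuclideanSpace.basisFun (Fin n) ℝ)]
    ext x
    simp [lap]
  have h3 : (fun y => f y - c * g y) = f - c • g := by ext; simp
  rw [h2, h2, h2, h3, ContDiffAt.laplacian_sub hf (show ContDiffAt ℝ 2 (c • g) x from hg.const_smul c),
    InnerProductSpace.laplacian_smul _ hg]
  simp

lemma DegZero.fderiv_self {g : 𝔼 → ℝ} (hg : DegZero g) {x : 𝔼} (hx : x ≠ 0)
    (hd : DifferentiableAt ℝ g x) : fderiv ℝ g x x = 0 := by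
  have h1 : HasDerivAt (fun τ : ℝ => g (τ • x)) (fderiv ℝ g x x) 1 := by
    have h2 : HasDerivAt (fun τ : ℝ => τ • x) x 1 := by
      simpa using (hasDerivAt_id (1 : ℝ)).smul_const x
    have h3 : HasFDerivAt g (fderiv ℝ g x) ((1 : ℝ) • x) := by simpa using hd.hasFDerivAt
    exact h3.comp_hasDerivAt (1 : ℝ) h2
  have h4 : HasDerivAt (fun τ : ℝ => g (τ • x)) 0 1 := by
    refine (hasDerivAt_const (1 : ℝ) (g x)).congr_of_eventuallyEq ?_
    filter_upwards [lt_mem_nhds (zero_lt_one' ℝ)] with τ hτ using hg τ hτ x hx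
  exact h1.unique h4

lemma sum_coord_mul_fderiv (l : 𝔼 →L[ℝ] ℝ) (x : 𝔼) :
    ∑ i : Fin n, x i * l (EuclideanSpace.single i 1) = l x := by
  conv_rhs => rw [← (EuclideanSpace.basisFun (Fin n) ℝ).sum_repr x]
  simp

lemma fderiv_normSq_single (x : 𝔼) (i : Fin n) :
    fderiv ℝ (fun y : 𝔼 => ‖y‖ ^ 2) x (EuclideanSpace.single i 1) = 2 * x i := by
  rw [fderiv_norm_sq_apply]
  simp [EuclideanSpace.inner_single_right]

lemma normSq_pos {x : 𝔼} (hx : x ≠ 0) : 0 < ‖x‖ ^ 2 := by positivity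

lemma contDiffAt_radial_mul {G : ℝ → ℝ} {w : 𝔼 → ℝ} {x : 𝔼} {k : WithTop ℕ∞}
    (hG : ContDiffAt ℝ k G (‖x‖ ^ 2)) (hw : ContDiffAt ℝ k w x) :
    ContDiffAt ℝ k (fun y => G (‖y‖ ^ 2) * w y) x := by
  refine ContDiffAt.mul ?_ hw
  exact hG.comp x (contDiff_norm_sq ℝ).contDiffAt

lemma fderiv_radial_mul {G : ℝ → ℝ} {G' : ℝ} {w : 𝔼 → ℝ} {x : 𝔼}
    (hG : HasDerivAt G G' (‖x‖ ^ 2)) (hw : DifferentiableAt ℝ w x) (i : Fin n) :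
    fderiv ℝ (fun y => G (‖y‖ ^ 2) * w y) x (EuclideanSpace.single i 1) =
      2 * x i * (G' * w x) + G (‖x‖ ^ 2) * fderiv ℝ w x (EuclideanSpace.single i 1) := by
  have hq : HasFDerivAt (fun y : 𝔼 => ‖y‖ ^ 2) (fderiv ℝ (fun y : 𝔼 => ‖y‖ ^ 2) x) x :=
    ((contDiff_norm_sq ℝ (n := 1)).differentiable (by norm_num) x).hasFDerivAt
  have h := (hG.comp_hasFDerivAt x hq).mul hw.hasFDerivAt
  have h' : HasFDerivAt (fun y => G (‖y‖ ^ 2) * w y) _ x := h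
  rw [h'.fderiv]
  simp only [add_apply, smul_apply, smul_eq_mul, fderiv_normSq_single, Function.comp]
  ring

/-- Laplacian of a radial function times a function homogeneous of degree zero. -/
lemma lap_radial_mul {G G' : ℝ → ℝ} {G'' : ℝ} {w : 𝔼 → ℝ} (hw : DegZero w) {x : 𝔼} (hx : x ≠ 0)
    (hC : ContDiffAt ℝ 2 G (‖x‖ ^ 2))
    (hG : ∀ t, 0 < t → HasDerivAt G (G' t) t) (hG' : HasDerivAt G' G'' (‖x‖ ^ 2))
    (hw2 : ∀ y ≠ 0, ContDiffAt ℝ 2 w y) :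
    lap n (fun y => G (‖y‖ ^ 2) * w y) x =
      (4 * ‖x‖ ^ 2 * G'' + 2 * n * G' (‖x‖ ^ 2)) * w x + G (‖x‖ ^ 2) * lap n w x := by
  have hdw : DifferentiableAt ℝ w x := (hw2 x hx).differentiableAt (by norm_num)
  have hdd : DifferentiableAt ℝ (fderiv ℝ w) x :=
    ((hw2 x hx).fderiv_right (m := 1) (by norm_num)).differentiableAt (by norm_num)
  rw [lap_eq_sum (contDiffAt_radial_mul hC (hw2 x hx)), lap_eq_sum (hw2 x hx)]
  have key (i : Fin n) :
      fderiv ℝ (fun y => fderiv ℝ (fun y => G (‖y‖ ^ 2) * w y) y (EuclideanSpace.single i 1)) x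
        (EuclideanSpace.single i 1) =
      4 * G'' * w x * (x i) ^ 2 + 2 * (G' (‖x‖ ^ 2) * w x)
      + 4 * G' (‖x‖ ^ 2) * (x i * fderiv ℝ w x (EuclideanSpace.single i 1))
      + G (‖x‖ ^ 2) * fderiv ℝ (fun y => fderiv ℝ w y (EuclideanSpace.single i 1)) x
        (EuclideanSpace.single i 1) := by
    have he : (fun y => fderiv ℝ (fun y => G (‖y‖ ^ 2) * w y) y (EuclideanSpace.single i 1))
        =ᶠ[𝓝 x] fun y => 2 * y i * (G' (‖y‖ ^ 2) * w y) +
          G (‖y‖ ^ 2) * fderiv ℝ w y (EuclideanSpace.single i 1) := by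
      filter_upwards [isOpen_ne.mem_nhds hx] with y hy
      exact fderiv_radial_mul (hG _ (normSq_pos hy)) ((hw2 y hy).differentiableAt (by norm_num)) i
    have hdi : DifferentiableAt ℝ (fun y => fderiv ℝ w y (EuclideanSpace.single i (1 : ℝ))) x :=
      hdd.clm_apply (by fun_prop)
    have hqd : DifferentiableAt ℝ (fun y : 𝔼 => ‖y‖ ^ 2) x :=
      (contDiff_norm_sq ℝ (n := 1)).differentiable (by norm_num) x
    have hd1 : DifferentiableAt ℝ (fun y : 𝔼 => G' (‖y‖ ^ 2) * w y) x :=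
      (DifferentiableAt.comp x hG'.differentiableAt hqd).mul hdw
    have hd2 : DifferentiableAt ℝ
        (fun y : 𝔼 => G (‖y‖ ^ 2) * fderiv ℝ w y (EuclideanSpace.single i 1)) x :=
      (DifferentiableAt.comp x (hG _ (normSq_pos hx)).differentiableAt hqd).mul hdi
    have hc : HasFDerivAt (fun y : 𝔼 => 2 * y i)
        ((2 : ℝ) • (EuclideanSpace.proj i : 𝔼 →L[ℝ] ℝ)) x :=
      (EuclideanSpace.proj i : 𝔼 →L[ℝ] ℝ).hasFDerivAt.const_mul 2
    rw [he.fderiv_eq, fderiv_fun_add (hc.differentiableAt.fun_mul hd1) hd2,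
      fderiv_fun_mul hc.differentiableAt hd1, hc.fderiv]
    simp only [add_apply, smul_apply, smul_eq_mul]
    rw [fderiv_radial_mul hG' hdw, fderiv_radial_mul (hG _ (normSq_pos hx)) hdi]
    simp
    ring
  simp only [key]
  have h1 : ∑ i : Fin n,
      4 * G' (‖x‖ ^ 2) * (x i * fderiv ℝ w x (EuclideanSpace.single i 1)) = 0 := by
    rw [← Finset.mul_sum, sum_coord_mul_fderiv, hw.fderiv_self hx hdw, mul_zero]
  rw [Finset.sum_add_distrib, Finset.sum_add_distrib, Finset.sum_add_distrib, h1,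
    Finset.mul_sum (a := G (‖x‖ ^ 2)), ← Finset.mul_sum, EuclideanSpace.norm_sq_eq]
  simp
  ring

lemma DegZero.normSq_mul_lap {g : 𝔼 → ℝ} (hg : DegZero g) (hg2 : ∀ y ≠ 0, ContDiffAt ℝ 2 g y) :
    DegZero fun x => ‖x‖ ^ 2 * lap n g x := by
  intro τ hτ x hx
  have hτx : τ • x ≠ 0 := smul_ne_zero hτ.ne' hx
  have h1 : lap n (fun y => g (τ • y)) x = lap n g x := by
    apply lap_congr
    filter_upwards [isOpen_ne.mem_nhds hx] with y hy using hg τ hτ y hy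
  have h2 : ContDiffAt ℝ 2 (fun y => g (τ • y)) x :=
    ContDiffAt.comp x (hg2 _ hτx) (contDiff_const_smul τ).contDiffAt
  have h3 : lap n (fun y => g (τ • y)) x = τ ^ 2 * lap n g (τ • x) := by
    rw [lap_eq_sum h2, lap_eq_sum (hg2 _ hτx), Finset.mul_sum]
    refine Finset.sum_congr rfl fun i _ => ?_
    have hdi : DifferentiableAt ℝ (fun z => fderiv ℝ g z (EuclideanSpace.single i (1 : ℝ)))
        (τ • x) :=
      (((hg2 _ hτx).fderiv_right (m := 1) (by norm_num)).differentiableAt (by norm_num)).clm_apply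
        (by fun_prop)
    have hdc : DifferentiableAt ℝ
        (fun y => (fun z => fderiv ℝ g z (EuclideanSpace.single i (1 : ℝ))) (τ • y)) x :=
      DifferentiableAt.comp x hdi (by fun_prop)
    have h4 : (fun y => fderiv ℝ (fun y => g (τ • y)) y (EuclideanSpace.single i (1 : ℝ))) =
        fun y => τ • (fun z => fderiv ℝ g z (EuclideanSpace.single i 1)) (τ • y) := by
      ext y
      rw [fderiv_comp_smul]
      simp
    rw [h4, fderiv_fun_const_smul hdc,
      fderiv_comp_smul (f := fun z => fderiv ℝ g z (EuclideanSpace.single i (1 : ℝ)))]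
    simp
    ring
  simp only [norm_smul, Real.norm_eq_abs, mul_pow, sq_abs]
  rw [← h1, h3]
  ring

end Calculus

section Integrals

variable {n : ℕ}

local notation "𝔼" => EuclideanSpace ℝ (Fin n)

lemma continuous_mul_of_tsupport {F h : 𝔼 → ℝ} (hF : Continuous F) (h0 : tsupport F ⊆ {0}ᶜ)
    (hh : ∀ x ≠ 0, ContinuousAt h x) : Continuous fun x => F x * h x := by
  refine continuous_of_tsupport fun x hx => ?_
  have hx0 : x ≠ 0 := h0 (tsupport_mul_subset_left hx)
  exact hF.continuousAt.mul (hh x hx0)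

lemma integrable_mul_of_tsupport {F h : 𝔼 → ℝ} (hF : Continuous F) (hc : HasCompactSupport F)
    (h0 : tsupport F ⊆ {0}ᶜ) (hh : ∀ x ≠ 0, ContinuousAt h x) :
    Integrable fun x => F x * h x :=
  (continuous_mul_of_tsupport hF h0 hh).integrable_of_hasCompactSupport hc.mul_right

lemma contDiff_of_contDiffAt_tsupport {F : 𝔼 → ℝ} {k : WithTop ℕ∞}
    (hF : ∀ x ∈ tsupport F, ContDiffAt ℝ k F x) : ContDiff ℝ k F := by
  refine contDiff_iff_contDiffAt.2 fun x => ?_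
  by_cases hx : x ∈ tsupport F
  · exact hF x hx
  · exact contDiffAt_const.congr_of_eventuallyEq (notMem_tsupport_iff_eventuallyEq.1 hx)

/-- Green's formula on the sphere, written with a radial cutoff. -/
lemma integral_radial_mul_lap {X X' : ℝ → ℝ} {g₁ g₂ : 𝔼 → ℝ}
    (hX : ∀ t, 0 < t → ContDiffAt ℝ 1 X t) (hX' : ∀ t, 0 < t → HasDerivAt X (X' t) t)
    (hc : HasCompactSupport fun x : 𝔼 => X (‖x‖ ^ 2))
    (h0 : tsupport (fun x : 𝔼 => X (‖x‖ ^ 2)) ⊆ {0}ᶜ)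
    (hg₁ : ∀ x ≠ 0, ContDiffAt ℝ 1 g₁ x) (hg₂ : ∀ x ≠ 0, ContDiffAt ℝ 2 g₂ x)
    (hd : DegZero g₂) :
    ∫ x, X (‖x‖ ^ 2) * g₁ x * lap n g₂ x =
      - ∫ x, X (‖x‖ ^ 2) * ∑ i : Fin n, fderiv ℝ g₁ x (EuclideanSpace.single i 1) *
        fderiv ℝ g₂ x (EuclideanSpace.single i 1) := by
  set F : 𝔼 → ℝ := fun x => X (‖x‖ ^ 2) * g₁ x with hF
  have hts : tsupport F ⊆ tsupport fun x : 𝔼 => X (‖x‖ ^ 2) := tsupport_mul_subset_left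
  have hF0 : tsupport F ⊆ {0}ᶜ := hts.trans h0
  have hFc : HasCompactSupport F := hc.mul_right
  have hF1 : ContDiff ℝ 1 F := contDiff_of_contDiffAt_tsupport fun x hx =>
    contDiffAt_radial_mul (hX _ (normSq_pos (hF0 hx))) (hg₁ x (hF0 hx))
  have hd2 (x : 𝔼) (hx : x ≠ 0) (i : Fin n) : ContDiffAt ℝ 1
      (fun y => fderiv ℝ g₂ y (EuclideanSpace.single i 1)) x :=
    ((hg₂ x hx).fderiv_right (m := 1) (by norm_num)).clm_apply contDiffAt_const
  have hdd (x : 𝔼) (hx : x ≠ 0) (i : Fin n) : ContinuousAt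
      (fun y => fderiv ℝ (fun y => fderiv ℝ g₂ y (EuclideanSpace.single i 1)) y
        (EuclideanSpace.single i 1)) x :=
    (((hd2 x hx i).fderiv_right (m := 0) (by norm_num)).clm_apply contDiffAt_const).continuousAt
  have hFd (i : Fin n) : Continuous fun y => fderiv ℝ F y (EuclideanSpace.single i 1) :=
    (hF1.continuous_fderiv (by norm_num)).clm_apply continuous_const
  have h_int (i : Fin n) : Integrable fun x => F x *
      fderiv ℝ (fun y => fderiv ℝ g₂ y (EuclideanSpace.single i 1)) x (EuclideanSpace.single i 1) :=
    integrable_mul_of_tsupport hF1.continuous hFc hF0 fun x hx => hdd x hx i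
  have h_int' (i : Fin n) : Integrable fun x => fderiv ℝ F x (EuclideanSpace.single i 1) *
      fderiv ℝ g₂ x (EuclideanSpace.single i 1) :=
    integrable_mul_of_tsupport (hFd i) (hFc.fderiv_apply ℝ _)
      ((tsupport_fderiv_apply_subset ℝ _).trans hF0) fun x hx => (hd2 x hx i).continuousAt
  have hparts (i : Fin n) := integral_mul_fderiv_eq_neg_fderiv_mul_of_integrable
    (μ := (volume : Measure 𝔼)) (h_int' i) (h_int i)
    (integrable_mul_of_tsupport hF1.continuous hFc hF0 fun x hx => (hd2 x hx i).continuousAt)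
    (fun x _ => hF1.differentiable (by norm_num) x)
    (fun x hx => (hd2 x (hF0 hx) i).differentiableAt (by norm_num))
  have hL (x : 𝔼) : F x * lap n g₂ x = ∑ i : Fin n, F x *
      fderiv ℝ (fun y => fderiv ℝ g₂ y (EuclideanSpace.single i 1)) x
        (EuclideanSpace.single i 1) := by
    by_cases hx : x = 0
    · have : F x = 0 := by
        by_contra h
        exact hF0 (subset_tsupport F h) hx
      simp [this]
    · rw [lap_eq_sum (hg₂ x hx), Finset.mul_sum]
  have hR (x : 𝔼) : X (‖x‖ ^ 2) * ∑ i : Fin n, fderiv ℝ g₁ x (EuclideanSpace.single i 1) *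
        fderiv ℝ g₂ x (EuclideanSpace.single i 1) = ∑ i : Fin n,
        fderiv ℝ F x (EuclideanSpace.single i 1) *
          fderiv ℝ g₂ x (EuclideanSpace.single i 1) := by
    by_cases hx : x = 0
    · have h1 : X (‖x‖ ^ 2) = 0 := by
        by_contra h
        exact h0 (subset_tsupport (fun x : 𝔼 => X (‖x‖ ^ 2)) h) hx
      have h2 : fderiv ℝ F x = 0 := by
        by_contra h
        exact hF0 (tsupport_fderiv_subset ℝ (subset_tsupport _ h)) hx
      simp [h1, h2]
    · have h3 (i : Fin n) : fderiv ℝ F x (EuclideanSpace.single i 1) *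
          fderiv ℝ g₂ x (EuclideanSpace.single i 1) =
          2 * (X' (‖x‖ ^ 2) * g₁ x) * (x i * fderiv ℝ g₂ x (EuclideanSpace.single i 1)) +
          X (‖x‖ ^ 2) * (fderiv ℝ g₁ x (EuclideanSpace.single i 1) *
            fderiv ℝ g₂ x (EuclideanSpace.single i 1)) := by
        rw [fderiv_radial_mul (hX' _ (normSq_pos hx)) ((hg₁ x hx).differentiableAt (by norm_num))]
        ring
      simp only [h3]
      rw [Finset.sum_add_distrib, ← Finset.mul_sum, ← Finset.mul_sum, sum_coord_mul_fderiv,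
        hd.fderiv_self hx ((hg₂ x hx).differentiableAt (by norm_num))]
      simp
  simp only [hR]
  rw [integral_congr_ae (Eventually.of_forall hL)]
  rw [integral_finsetSum _ fun i _ => h_int i, integral_finsetSum _ fun i _ => h_int' i,
    ← Finset.sum_neg_distrib]
  exact Finset.sum_congr rfl fun i _ => hparts i

lemma tsupport_log_cutoff {H : ℝ → ℝ} (hH : HasCompactSupport H) {s : ℝ} (hs : s ≠ 0) :
    HasCompactSupport (fun x : 𝔼 => (‖x‖ ^ 2) ^ s * H (Real.log (‖x‖ ^ 2))) ∧
      tsupport (fun x : 𝔼 => (‖x‖ ^ 2) ^ s * H (Real.log (‖x‖ ^ 2))) ⊆ {0}ᶜ := by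
  obtain ⟨R, hR⟩ := hH.isCompact.isBounded.subset_closedBall 0
  set K : Set 𝔼 := (fun x : 𝔼 => ‖x‖ ^ 2) ⁻¹' Icc (Real.exp (-R)) (Real.exp R) with hK
  have hKc : IsClosed K := isClosed_Icc.preimage (by fun_prop)
  have hKcpt : IsCompact K := by
    refine Metric.isCompact_of_isClosed_isBounded hKc
      ((isBounded_closedBall (x := (0 : 𝔼)) (r := 1 + Real.exp R)).subset fun x hx => ?_)
    have h1 : ‖x‖ ^ 2 ≤ Real.exp R := hx.2
    rw [mem_closedBall_zero_iff]
    nlinarith [norm_nonneg x, Real.exp_pos R, sq_nonneg (‖x‖ - 1)]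
  have hsub : Function.support (fun x : 𝔼 => (‖x‖ ^ 2) ^ s * H (Real.log (‖x‖ ^ 2))) ⊆ K := by
    intro x hx
    have hx' : (‖x‖ ^ 2) ^ s * H (Real.log (‖x‖ ^ 2)) ≠ 0 := hx
    have hx0 : x ≠ 0 := by
      rintro rfl
      exact hx' (by simp [Real.zero_rpow hs])
    have h1 := hR (subset_tsupport H (right_ne_zero_of_mul hx'))
    rw [mem_closedBall_zero_iff, Real.norm_eq_abs, abs_le] at h1
    exact ⟨(Real.le_log_iff_exp_le (normSq_pos hx0)).1 h1.1,
      (Real.log_le_iff_le_exp (normSq_pos hx0)).1 h1.2⟩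
  refine ⟨HasCompactSupport.of_support_subset_isCompact hKcpt hsub,
    (closure_minimal hsub hKc).trans ?_⟩
  rintro x hx rfl
  have : Real.exp (-R) ≤ ‖(0 : 𝔼)‖ ^ 2 := hx.1
  simp at this
  linarith [Real.exp_pos (-R)]

lemma integral_Ioi_log (H : ℝ → ℝ) :
    ∫ r in Ioi (0 : ℝ), r⁻¹ * H (Real.log (r ^ 2)) = 1 / 2 * ∫ t, H t := by
  have himg : (fun t : ℝ => Real.exp (t / 2)) '' univ = Ioi 0 := by
    ext r
    simp only [image_univ, mem_range, mem_Ioi]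
    refine ⟨fun ⟨t, ht⟩ => ht ▸ Real.exp_pos _, fun hr => ⟨2 * Real.log r, ?_⟩⟩
    rw [mul_div_cancel_left₀ _ two_ne_zero, Real.exp_log hr]
  have hder (t : ℝ) : HasDerivAt (fun t : ℝ => Real.exp (t / 2)) (Real.exp (t / 2) * (1 / 2)) t :=
    ((hasDerivAt_id t).div_const 2).exp
  have hinj : InjOn (fun t : ℝ => Real.exp (t / 2)) univ := by
    intro t _ t' _ h
    have := Real.exp_injective h
    linarith
  rw [← himg, integral_image_eq_integral_abs_deriv_smul MeasurableSet.univ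
    (fun t _ => (hder t).hasDerivWithinAt) hinj, Measure.restrict_univ, ← integral_const_mul]
  congr 1
  ext t
  rw [← Real.exp_nat_mul, Real.log_exp, abs_of_pos (by positivity), smul_eq_mul]
  have : Real.exp (t / 2) ≠ 0 := (Real.exp_pos _).ne'
  push_cast
  rw [mul_div_cancel₀ _ two_ne_zero]
  field_simp

/-- Integration in polar coordinates of a radial function times a function homogeneous of
degree zero. -/
lemma integral_radial_mul_degZero (hn : 0 < n) (H : ℝ → ℝ) {g : 𝔼 → ℝ} (hg : DegZero g) :
    ∫ x : 𝔼, (‖x‖ ^ 2) ^ (-(n : ℝ) / 2) * H (Real.log (‖x‖ ^ 2)) * g x =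
      (1 / 2 * ∫ t, H t) * ∫ y : sphere (0 : 𝔼) 1, g y ∂(volume : Measure 𝔼).toSphere := by
  have : NeZero n := ⟨hn.ne'⟩
  set k : ℝ → ℝ := fun r => (r ^ 2) ^ (-(n : ℝ) / 2) * H (Real.log (r ^ 2)) with hk
  calc
    _ = ∫ x : ({(0)}ᶜ : Set 𝔼), k ‖x.1‖ * g x.1 ∂((volume : Measure 𝔼).comap (↑)) := by
      rw [integral_subtype_comap (measurableSet_singleton _).compl fun x : 𝔼 ↦ k ‖x‖ * g x,
        restrict_compl_singleton]
    _ = ∫ z, g z.1 * k z.2 ∂(volume : Measure 𝔼).toSphere.prod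
          (.volumeIoiPow (Module.finrank ℝ 𝔼 - 1)) := by
      rw [← (volume : Measure 𝔼).measurePreserving_homeomorphUnitSphereProd.integral_comp
        (Homeomorph.measurableEmbedding _)]
      refine integral_congr_ae (Eventually.of_forall fun x => ?_)
      have hx : (x : 𝔼) ≠ 0 := x.2
      simp only [homeomorphUnitSphereProd_apply_fst_coe, homeomorphUnitSphereProd_apply_snd_coe]
      rw [hg _ (inv_pos.2 (norm_pos_iff.2 hx)) _ hx, mul_comm]
    _ = (∫ y : sphere (0 : 𝔼) 1, g y ∂(volume : Measure 𝔼).toSphere) *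
          ∫ r : Ioi (0 : ℝ), k r ∂.volumeIoiPow (Module.finrank ℝ 𝔼 - 1) :=
      integral_prod_mul (fun y : sphere (0 : 𝔼) 1 => g y) (fun r : Ioi (0 : ℝ) => k r)
    _ = _ := by
      rw [mul_comm, ← integral_Ioi_log]
      congr 1
      simp only [Measure.volumeIoiPow, ENNReal.ofReal]
      rw [integral_withDensity_eq_integral_smul,
        integral_subtype_comap measurableSet_Ioi fun a ↦
          Real.toNNReal (a ^ (Module.finrank ℝ 𝔼 - 1)) • k a,
        setIntegral_congr_fun measurableSet_Ioi fun x hx ↦ ?_]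
      · have hx : 0 < x := hx
        simp only [hk]
        rw [NNReal.smul_def, Real.coe_toNNReal _ (pow_nonneg hx.le _), smul_eq_mul, ← mul_assoc,
          finrank_euclideanSpace_fin, ← Real.rpow_natCast x 2, ← Real.rpow_mul hx.le,
          ← Real.rpow_natCast x (n - 1), ← Real.rpow_add hx, ← Real.rpow_neg_one]
        congr 2
        rw [Nat.cast_sub hn]
        push_cast
        ring
      · exact (measurable_subtype_coe.pow_const _).real_toNNReal

end Integrals

section Mollification

open ContinuousLinearMap Convolution

variable {n : ℕ}

local notation "𝔼" => EuclideanSpace ℝ (Fin n)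

lemma support_normed_convolution_subset (φ : ContDiffBump (0 : 𝔼)) {g : 𝔼 → ℝ} {K : Set 𝔼} {δ : ℝ}
    (hφ : φ.rOut ≤ δ) (hg : tsupport g ⊆ K) :
    Function.support (φ.normed volume ⋆[lsmul ℝ ℝ, volume] g) ⊆ cthickening δ K := by
  refine (support_convolution_subset _).trans ?_
  rintro _ ⟨y, hy, z, hz, rfl⟩
  rw [φ.support_normed_eq, mem_ball_zero_iff] at hy
  refine mem_cthickening_of_dist_le _ z _ _ (hg (subset_tsupport g hz)) ?_
  simpa using hy.le.trans hφ

lemma abs_normed_convolution_le (φ : ContDiffBump (0 : 𝔼)) {g : 𝔼 → ℝ} (hg : Continuous g) {M : ℝ}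
    (hM : ∀ x, |g x| ≤ M) (x : 𝔼) :
    |(φ.normed volume ⋆[lsmul ℝ ℝ, volume] g) x| ≤ 3 * M := by
  have h := φ.dist_normed_convolution_le (μ := volume) (x₀ := x) (ε := 2 * M)
    hg.aestronglyMeasurable fun y _ => by
      rw [Real.dist_eq]
      linarith [abs_sub (g y) (g x), hM x, hM y]
  rw [Real.dist_eq] at h
  have h2 := abs_add_le ((φ.normed volume ⋆[lsmul ℝ ℝ, volume] g) x - g x) (g x)
  rw [sub_add_cancel] at h2
  linarith [hM x]

lemma fderiv_normed_convolution (φ : ContDiffBump (0 : 𝔼)) {g : 𝔼 → ℝ} (hg : ContDiff ℝ 1 g)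
    (hc : HasCompactSupport g) (e : 𝔼) :
    (fun x => fderiv ℝ (φ.normed volume ⋆[lsmul ℝ ℝ, volume] g) x e) =
      φ.normed volume ⋆[lsmul ℝ ℝ, volume] fun x => fderiv ℝ g x e := by
  ext x
  have hl : LocallyIntegrable (φ.normed volume) (volume : Measure 𝔼) :=
    φ.continuous_normed.locallyIntegrable
  rw [(hc.hasFDerivAt_convolution_right (lsmul ℝ ℝ) hl hg x).fderiv]
  exact convolution_precompR_apply (lsmul ℝ ℝ) hl (hc.fderiv ℝ)
    (hg.continuous_fderiv (by norm_num)) x e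

lemma contDiff_normed_convolution (φ : ContDiffBump (0 : 𝔼)) {g : 𝔼 → ℝ} (hg : Continuous g) :
    ContDiff ℝ (⊤ : ℕ∞) (φ.normed volume ⋆[lsmul ℝ ℝ, volume] g) :=
  φ.hasCompactSupport_normed.contDiff_convolution_left _ φ.contDiff_normed hg.locallyIntegrable

lemma lap_normed_convolution (φ : ContDiffBump (0 : 𝔼)) {g : 𝔼 → ℝ} (hg : ContDiff ℝ 2 g)
    (hc : HasCompactSupport g) (x : 𝔼) :
    lap n (φ.normed volume ⋆[lsmul ℝ ℝ, volume] g) x = ∑ i : Fin n,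
      (φ.normed volume ⋆[lsmul ℝ ℝ, volume] fun y =>
        fderiv ℝ (fun z => fderiv ℝ g z (EuclideanSpace.single i 1)) y
          (EuclideanSpace.single i 1)) x := by
  have h : ContDiff ℝ 2 (φ.normed volume ⋆[lsmul ℝ ℝ, volume] g) := by
    exact_mod_cast contDiff_infty.1 (contDiff_normed_convolution φ hg.continuous) 2
  rw [lap_eq_sum h.contDiffAt]
  refine Finset.sum_congr rfl fun i _ => ?_
  rw [fderiv_normed_convolution φ (hg.of_le (by norm_num)) hc]
  exact congrFun (fderiv_normed_convolution φ
    ((hg.fderiv_right (m := 1) (by norm_num)).clm_apply contDiff_const)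
    (hc.fderiv_apply ℝ _) (EuclideanSpace.single i 1)) x

/-- A quadratic inequality valid for smooth test functions extends to `C²` test functions. -/
lemma stability_of_contDiff_two {V : 𝔼 → ℝ} {p : ℝ} (hV : ∀ x ≠ 0, ContinuousAt V x)
    (hst : ∀ ψ : 𝔼 → ℝ, ContDiff ℝ (⊤ : ℕ∞) ψ → HasCompactSupport ψ → tsupport ψ ⊆ {0}ᶜ →
      p * ∫ x, V x * ψ x ^ 2 ≤ ∫ x, lap n ψ x ^ 2)
    {ψ : 𝔼 → ℝ} (hψ : ContDiff ℝ 2 ψ) (hc : HasCompactSupport ψ) (h0 : tsupport ψ ⊆ {0}ᶜ) :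
    p * ∫ x, V x * ψ x ^ 2 ≤ ∫ x, lap n ψ x ^ 2 := by
  obtain ⟨δ, hδ, hδK⟩ := hc.isCompact.exists_cthickening_subset_open isOpen_compl_singleton h0
  set K := cthickening δ (tsupport ψ) with hK
  have hKc : IsCompact K := hc.isCompact.cthickening
  have hr (k : ℕ) : 0 < δ / (k + 1) := by positivity
  let φ (k : ℕ) : ContDiffBump (0 : 𝔼) :=
    ⟨δ / (k + 1) / 2, δ / (k + 1), half_pos (hr k), half_lt_self (hr k)⟩
  have hφδ (k : ℕ) : (φ k).rOut ≤ δ :=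
    div_le_self hδ.le (by linarith [(Nat.cast_nonneg k : (0 : ℝ) ≤ k)])
  have hφ0 : Tendsto (fun k => (φ k).rOut) atTop (𝓝 0) :=
    tendsto_const_div_atTop_nhds_zero_nat δ |>.comp (tendsto_add_atTop_nat 1) |>.congr fun k => by
      simp [φ]
  set Ψ : ℕ → 𝔼 → ℝ := fun k => (φ k).normed volume ⋆[lsmul ℝ ℝ, volume] ψ with hΨ
  set D : Fin n → 𝔼 → ℝ := fun i y => fderiv ℝ (fun z => fderiv ℝ ψ z (EuclideanSpace.single i 1)) y
    (EuclideanSpace.single i 1) with hD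
  have hDcont (i : Fin n) : Continuous (D i) :=
    (((hψ.fderiv_right (m := 1) (by norm_num)).clm_apply contDiff_const).continuous_fderiv
      (by norm_num)).clm_apply continuous_const
  have hDs (i : Fin n) : tsupport (D i) ⊆ tsupport ψ :=
    (tsupport_fderiv_apply_subset ℝ _).trans (tsupport_fderiv_apply_subset ℝ _)
  have hΨsupp (k : ℕ) : Function.support (Ψ k) ⊆ K :=
    support_normed_convolution_subset (φ k) (hφδ k) subset_rfl
  have hΨt (k : ℕ) : tsupport (Ψ k) ⊆ K := closure_minimal (hΨsupp k) isClosed_cthickening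
  have hΨc (k : ℕ) : HasCompactSupport (Ψ k) :=
    HasCompactSupport.of_support_subset_isCompact hKc (hΨsupp k)
  have hΨs (k : ℕ) : ContDiff ℝ (⊤ : ℕ∞) (Ψ k) := contDiff_normed_convolution (φ k) hψ.continuous
  have hlapΨ (k : ℕ) (x : 𝔼) : lap n (Ψ k) x = ∑ i : Fin n,
      ((φ k).normed volume ⋆[lsmul ℝ ℝ, volume] D i) x := lap_normed_convolution (φ k) hψ hc x
  obtain ⟨M, hM⟩ := hψ.continuous.bounded_above_of_compact_support hc
  have hDc (i : Fin n) : HasCompactSupport (D i) := hc.of_isClosed_subset (isClosed_tsupport _) (hDs i)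
  choose N hN using fun i => (hDcont i).bounded_above_of_compact_support (hDc i)
  have hleft : Tendsto (fun k => ∫ x, V x * Ψ k x ^ 2) atTop (𝓝 (∫ x, V x * ψ x ^ 2)) := by
    refine tendsto_integral_of_dominated_convergence
      (K.indicator fun x => |V x| * (3 * M) ^ 2) (fun k => ?_) ?_ (fun k => ?_) ?_
    · have hs : tsupport (fun x => Ψ k x ^ 2) ⊆ {0}ᶜ := by
        refine Subset.trans ?_ ((hΨt k).trans hδK)
        exact closure_mono fun x hx h => hx (by simp [h])
      have h := continuous_mul_of_tsupport ((hΨs k).continuous.pow 2) hs hV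
      refine Continuous.aestronglyMeasurable ?_
      exact h.congr fun x => mul_comm _ _
    · rw [integrable_indicator_iff hKc.measurableSet]
      refine ContinuousOn.integrableOn_compact hKc fun x hx => ?_
      exact ((hV x (hδK hx)).abs.mul continuousAt_const).continuousWithinAt
    · refine Eventually.of_forall fun x => ?_
      by_cases hx : x ∈ K
      · rw [indicator_of_mem hx, norm_mul, Real.norm_eq_abs, norm_pow, Real.norm_eq_abs]
        gcongr
        exact abs_normed_convolution_le (φ k) hψ.continuous hM x
      · have : Ψ k x = 0 := by
          by_contra h
          exact hx (hΨsupp k h)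
        simp [hx, this]
    · refine Eventually.of_forall fun x => ?_
      exact ((ContDiffBump.convolution_tendsto_right_of_continuous hφ0 hψ.continuous x).pow
        2).const_mul _
  have hright : Tendsto (fun k => ∫ x, lap n (Ψ k) x ^ 2) atTop (𝓝 (∫ x, lap n ψ x ^ 2)) := by
    refine tendsto_integral_of_dominated_convergence
      (K.indicator fun _ => (∑ i, 3 * N i) ^ 2) (fun k => ?_) ?_ (fun k => ?_) ?_
    · simp only [hlapΨ]
      exact ((continuous_finsetSum _ fun i _ => (contDiff_normed_convolution (φ k)
        (hDcont i)).continuous).pow 2).aestronglyMeasurable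
    · rw [integrable_indicator_iff hKc.measurableSet]
      exact continuousOn_const.integrableOn_compact hKc
    · refine Eventually.of_forall fun x => ?_
      rw [hlapΨ]
      by_cases hx : x ∈ K
      · rw [indicator_of_mem hx, norm_pow, Real.norm_eq_abs]
        gcongr
        exact (Finset.abs_sum_le_sum_abs _ _).trans (Finset.sum_le_sum fun i _ =>
          abs_normed_convolution_le (φ k) (hDcont i) (hN i) x)
      · have (i : Fin n) : ((φ k).normed volume ⋆[lsmul ℝ ℝ, volume] D i) x = 0 := by
          by_contra h
          exact hx (support_normed_convolution_subset (φ k) (hφδ k) (hDs i) h)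
        simp [hx, this]
    · refine Eventually.of_forall fun x => ?_
      simp only [hlapΨ]
      rw [lap_eq_sum hψ.contDiffAt]
      exact (tendsto_finsetSum _ fun i _ =>
        ContDiffBump.convolution_tendsto_right_of_continuous hφ0 (hDcont i) x).pow 2
  exact le_of_tendsto_of_tendsto' (hleft.const_mul p) hright fun k =>
    hst (Ψ k) (hΨs k) (hΨc k) ((hΨt k).trans hδK)

end Mollification

section Sphere

variable {n : ℕ}

local notation "𝔼" => EuclideanSpace ℝ (Fin n)

/-- Integral over the unit sphere. -/
noncomputable def unitSphereInt (g : 𝔼 → ℝ) : ℝ :=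
  ∫ y : sphere (0 : 𝔼) 1, g y ∂(volume : Measure 𝔼).toSphere

lemma continuous_restrict_sphere {g : 𝔼 → ℝ} (hg : ∀ x ≠ 0, ContinuousAt g x) :
    Continuous fun y : sphere (0 : 𝔼) 1 => g y :=
  continuous_iff_continuousAt.2 fun y =>
    ContinuousAt.comp (f := ((↑) : sphere (0 : 𝔼) 1 → 𝔼)) (hg y (ne_zero_of_mem_unit_sphere y))
      continuous_subtype_val.continuousAt

lemma integrable_sphere {g : 𝔼 → ℝ} (hg : ∀ x ≠ 0, ContinuousAt g x) :
    Integrable (fun y : sphere (0 : 𝔼) 1 => g y) (volume : Measure 𝔼).toSphere :=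
  (continuous_restrict_sphere hg).integrable_of_hasCompactSupport
    (HasCompactSupport.of_compactSpace _)

lemma unitSphereInt_congr {f g : 𝔼 → ℝ} (h : ∀ x, ‖x‖ = 1 → f x = g x) :
    unitSphereInt f = unitSphereInt g := by
  unfold unitSphereInt
  congr 1
  ext y
  exact h y (norm_eq_of_mem_sphere y)

lemma eq_zero_of_unitSphereInt_sq_nonpos {g : 𝔼 → ℝ} (hg : ∀ x ≠ 0, ContinuousAt g x)
    (hd : DegZero g) (h : unitSphereInt (fun x => g x ^ 2) ≤ 0) : ∀ x ≠ 0, g x = 0 := by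
  have h1 : ∀ y : sphere (0 : 𝔼) 1, g y = 0 := by
    by_contra! hne
    obtain ⟨y, hy⟩ := hne
    have := (continuous_restrict_sphere hg).pow 2
    have hpos := Continuous.integral_pos_of_hasCompactSupport_nonneg_nonzero
      (μ := (volume : Measure 𝔼).toSphere) this (HasCompactSupport.of_compactSpace _)
      (fun y => sq_nonneg _) (x := y) (pow_ne_zero 2 hy)
    exact absurd h (not_le.2 hpos)
  intro x hx
  have hx' : 0 < ‖x‖⁻¹ := inv_pos.2 (norm_pos_iff.2 hx)
  rw [← hd _ hx' x hx]
  exact h1 ⟨‖x‖⁻¹ • x, by simp [norm_smul, hx]⟩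

lemma DegZero.mul {f g : 𝔼 → ℝ} (hf : DegZero f) (hg : DegZero g) :
    DegZero fun x => f x * g x := fun τ hτ x hx => by
  simp only [hf τ hτ x hx, hg τ hτ x hx]

lemma integral_scaled_cutoff_mul (hn : 0 < n) (H : ℝ → ℝ) {ε : ℝ} (hε : 0 < ε) {g : 𝔼 → ℝ}
    (hg : DegZero g) :
    ∫ x : 𝔼, (‖x‖ ^ 2) ^ (-(n : ℝ) / 2) * H (ε * Real.log (‖x‖ ^ 2)) * g x =
      (2 * ε)⁻¹ * (∫ t, H t) * unitSphereInt g := by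
  rw [integral_radial_mul_degZero hn (fun t => H (ε * t)) hg, Measure.integral_comp_mul_left,
    abs_of_pos (inv_pos.2 hε), unitSphereInt, smul_eq_mul]
  ring

lemma hasCompactSupport_comp_const_mul {H : ℝ → ℝ} (hH : HasCompactSupport H) {ε : ℝ} (hε : 0 < ε) :
    HasCompactSupport fun t => H (ε * t) := by
  simpa using hH.comp_smul hε.ne'

lemma continuous_log_cutoff {H : ℝ → ℝ} (hH : HasCompactSupport H) (hHc : Continuous H) {s : ℝ}
    (hs : s ≠ 0) : Continuous fun x : 𝔼 => (‖x‖ ^ 2) ^ s * H (Real.log (‖x‖ ^ 2)) := by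
  refine continuous_of_tsupport fun x hx => ?_
  have hx0 : ‖x‖ ^ 2 ≠ 0 := (normSq_pos ((tsupport_log_cutoff hH hs).2 hx)).ne'
  have hq : ContinuousAt (fun x : 𝔼 => ‖x‖ ^ 2) x := by fun_prop
  exact (hq.rpow_const (Or.inl hx0)).mul (hHc.continuousAt.comp (hq.log hx0))

lemma integrable_scaled_cutoff_mul {H : ℝ → ℝ} (hH : HasCompactSupport H) (hHc : Continuous H)
    {s ε : ℝ} (hs : s ≠ 0) (hε : 0 < ε) {g : 𝔼 → ℝ} (hg : ∀ x ≠ 0, ContinuousAt g x) :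
    Integrable fun x : 𝔼 => (‖x‖ ^ 2) ^ s * H (ε * Real.log (‖x‖ ^ 2)) * g x := by
  have h := hasCompactSupport_comp_const_mul hH hε
  exact integrable_mul_of_tsupport
    (continuous_log_cutoff (H := fun t => H (ε * t)) h (by fun_prop) hs)
    (tsupport_log_cutoff h hs).1 (tsupport_log_cutoff h hs).2 hg

/-- A smooth bump function on the line. -/
noncomputable def lineBump : ContDiffBump (0 : ℝ) := ⟨1, 2, one_pos, one_lt_two⟩

lemma unitSphereInt_mul_lap_eq (hn : 5 ≤ n) {g₁ g₂ : 𝔼 → ℝ} (hd₁ : DegZero g₁) (hd₂ : DegZero g₂)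
    (hg₁ : ∀ x ≠ 0, ContDiffAt ℝ 1 g₁ x) (hg₂ : ∀ x ≠ 0, ContDiffAt ℝ 2 g₂ x) :
    (2⁻¹ * ∫ t, lineBump t) * unitSphereInt (fun x => g₁ x * (‖x‖ ^ 2 * lap n g₂ x)) =
      -∫ x : 𝔼, (‖x‖ ^ 2) ^ (-(n : ℝ) / 2 + 1) * lineBump (Real.log (‖x‖ ^ 2)) *
        ∑ i : Fin n, fderiv ℝ g₁ x (EuclideanSpace.single i 1) *
          fderiv ℝ g₂ x (EuclideanSpace.single i 1) := by
  have hn' : (5 : ℝ) ≤ n := by exact_mod_cast hn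
  have hs : -(n : ℝ) / 2 + 1 ≠ 0 := by linarith
  have hX (t : ℝ) (ht : 0 < t) :
      ContDiffAt ℝ 1 (fun t : ℝ => t ^ (-(n : ℝ) / 2 + 1) * lineBump (Real.log t)) t :=
    (Real.contDiffAt_rpow_const_of_ne ht.ne').mul
      (lineBump.contDiffAt.comp t (Real.contDiffAt_log.2 ht.ne'))
  have hsupp := tsupport_log_cutoff (n := n) lineBump.hasCompactSupport hs
  rw [← integral_radial_mul_lap hX
    (fun t ht => ((hX t ht).differentiableAt (by norm_num)).hasDerivAt) hsupp.1 hsupp.2 hg₁ hg₂ hd₂]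
  have h := integral_scaled_cutoff_mul (n := n) (by omega) lineBump one_pos
    (hd₁.mul (hd₂.normSq_mul_lap hg₂))
  rw [mul_one] at h
  rw [← h]
  refine integral_congr_ae (Eventually.of_forall fun x => ?_)
  simp only [one_mul]
  by_cases hx : x = 0
  · simp [hx, Real.zero_rpow hs]
  · rw [Real.rpow_add_one (normSq_pos hx).ne']
    ring

lemma half_integral_lineBump_pos : 0 < 2⁻¹ * ∫ t, lineBump t := by
  have := lineBump.integral_pos (μ := (volume : Measure ℝ))
  positivity

lemma unitSphereInt_mul_lap_comm (hn : 5 ≤ n) {g₁ g₂ : 𝔼 → ℝ} (hd₁ : DegZero g₁)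
    (hd₂ : DegZero g₂) (hg₁ : ∀ x ≠ 0, ContDiffAt ℝ 2 g₁ x) (hg₂ : ∀ x ≠ 0, ContDiffAt ℝ 2 g₂ x) :
    unitSphereInt (fun x => g₁ x * (‖x‖ ^ 2 * lap n g₂ x)) =
      unitSphereInt (fun x => g₂ x * (‖x‖ ^ 2 * lap n g₁ x)) := by
  have h₁ := unitSphereInt_mul_lap_eq hn hd₁ hd₂ (fun x hx => (hg₁ x hx).of_le (by norm_num)) hg₂
  have h₂ := unitSphereInt_mul_lap_eq hn hd₂ hd₁ (fun x hx => (hg₂ x hx).of_le (by norm_num)) hg₁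
  refine mul_left_cancel₀ half_integral_lineBump_pos.ne' (h₁.trans (Eq.trans ?_ h₂.symm))
  simp only [mul_comm (fderiv ℝ g₁ _ _)]

lemma unitSphereInt_mul_lap_self_nonpos (hn : 5 ≤ n) {g : 𝔼 → ℝ} (hd : DegZero g)
    (hg : ∀ x ≠ 0, ContDiffAt ℝ 2 g x) :
    unitSphereInt (fun x => g x * (‖x‖ ^ 2 * lap n g x)) ≤ 0 := by
  have h := unitSphereInt_mul_lap_eq hn hd hd (fun x hx => (hg x hx).of_le (by norm_num)) hg
  have h2 : 0 ≤ ∫ x : 𝔼, (‖x‖ ^ 2) ^ (-(n : ℝ) / 2 + 1) * lineBump (Real.log (‖x‖ ^ 2)) *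
        ∑ i : Fin n, fderiv ℝ g x (EuclideanSpace.single i 1) *
          fderiv ℝ g x (EuclideanSpace.single i 1) := by
    refine integral_nonneg fun x => ?_
    exact mul_nonneg (mul_nonneg (by positivity) lineBump.nonneg)
      (Finset.sum_nonneg fun i _ => mul_self_nonneg _)
  by_contra! hpos
  have := mul_pos half_integral_lineBump_pos hpos
  linarith

lemma lap_rpow_mul {w : 𝔼 → ℝ} (hw : DegZero w) (hw2 : ∀ y ≠ 0, ContDiffAt ℝ 2 w y) (s : ℝ) {x : 𝔼}
    (hx : x ≠ 0) :
    lap n (fun y => (‖y‖ ^ 2) ^ s * w y) x =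
      (‖x‖ ^ 2) ^ (s - 1) * (‖x‖ ^ 2 * lap n w x + 2 * s * (2 * s + n - 2) * w x) := by
  have hq := normSq_pos hx
  rw [lap_radial_mul (G := fun t => t ^ s) (G' := fun t => s * t ^ (s - 1))
    (G'' := s * ((s - 1) * (‖x‖ ^ 2) ^ (s - 1 - 1))) hw hx
    (Real.contDiffAt_rpow_const_of_ne hq.ne')
    (fun t ht => Real.hasDerivAt_rpow_const (Or.inl ht.ne'))
    ((Real.hasDerivAt_rpow_const (Or.inl hq.ne')).const_mul s) hw2]
  have h1 : (‖x‖ ^ 2) ^ s = (‖x‖ ^ 2) ^ (s - 1 - 1) * ‖x‖ ^ 2 * ‖x‖ ^ 2 := by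
    rw [← Real.rpow_add_one hq.ne', ← Real.rpow_add_one hq.ne']
    ring_nf
  have h2 : (‖x‖ ^ 2) ^ (s - 1) = (‖x‖ ^ 2) ^ (s - 1 - 1) * ‖x‖ ^ 2 := by
    rw [← Real.rpow_add_one hq.ne']
    ring_nf
  rw [h1, h2]
  ring

end Sphere

section Stability

variable {n : ℕ}

local notation "𝔼" => EuclideanSpace ℝ (Fin n)

lemma lap_scaled_cutoff_mul {φ φ' φ'' : ℝ → ℝ} (hφ : ContDiff ℝ 2 φ)
    (hφ' : ∀ t, HasDerivAt φ (φ' t) t) (hφ'' : ∀ t, HasDerivAt φ' (φ'' t) t) (ε : ℝ) {w : 𝔼 → ℝ}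
    (hw : DegZero w) (hw2 : ∀ y ≠ 0, ContDiffAt ℝ 2 w y) {x : 𝔼} (hx : x ≠ 0) :
    lap n (fun y => (‖y‖ ^ 2) ^ (-(n : ℝ) / 4 + 1) * φ (ε * Real.log (‖y‖ ^ 2)) * w y) x =
      (‖x‖ ^ 2) ^ (-(n : ℝ) / 4) *
        ((4 * ε ^ 2 * φ'' (ε * Real.log (‖x‖ ^ 2)) + 4 * ε * φ' (ε * Real.log (‖x‖ ^ 2)) -
          n * (n - 4) / 4 * φ (ε * Real.log (‖x‖ ^ 2))) * w x +
          φ (ε * Real.log (‖x‖ ^ 2)) * (‖x‖ ^ 2 * lap n w x)) := by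
  have hq := normSq_pos hx
  set s : ℝ := -(n : ℝ) / 4 with hs
  have hlog (t : ℝ) (ht : 0 < t) : HasDerivAt (fun t => ε * Real.log t) (ε * t⁻¹) t :=
    (Real.hasDerivAt_log ht.ne').const_mul ε
  have hpow (r t : ℝ) (ht : 0 < t) : HasDerivAt (fun t : ℝ => t ^ r) (r * t ^ (r - 1)) t :=
    Real.hasDerivAt_rpow_const (Or.inl ht.ne')
  have h1 (t : ℝ) (ht : 0 < t) : HasDerivAt (fun t => t ^ (s + 1) * φ (ε * Real.log t))
      (t ^ s * ((s + 1) * φ (ε * Real.log t) + ε * φ' (ε * Real.log t))) t := by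
    refine ((hpow (s + 1) t ht).mul ((hφ' _).comp t (hlog t ht))).congr_deriv ?_
    rw [add_sub_cancel_right, Function.comp_apply, Real.rpow_add_one ht.ne']
    field_simp
  have h2 (t : ℝ) (ht : 0 < t) :
      HasDerivAt (fun t => t ^ s * ((s + 1) * φ (ε * Real.log t) + ε * φ' (ε * Real.log t)))
        (t ^ (s - 1) * (s * ((s + 1) * φ (ε * Real.log t) + ε * φ' (ε * Real.log t)) +
          ((s + 1) * ε * φ' (ε * Real.log t) + ε ^ 2 * φ'' (ε * Real.log t)))) t := by
    refine ((hpow s t ht).mul ((((hφ' _).comp t (hlog t ht)).const_mul (s + 1)).add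
      (((hφ'' _).comp t (hlog t ht)).const_mul ε))).congr_deriv ?_
    simp only [Pi.add_apply, Function.comp_apply]
    have : t ^ s = t ^ (s - 1) * t := by rw [← Real.rpow_add_one ht.ne', sub_add_cancel]
    rw [this]
    field_simp
  have hC : ContDiffAt ℝ 2 (fun t => t ^ (s + 1) * φ (ε * Real.log t)) (‖x‖ ^ 2) :=
    (Real.contDiffAt_rpow_const_of_ne hq.ne').mul
      (hφ.contDiffAt.comp _ (contDiffAt_const.mul (Real.contDiffAt_log.2 hq.ne')))
  rw [lap_radial_mul (G := fun t => t ^ (s + 1) * φ (ε * Real.log t)) hw hx hC h1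
    (h2 _ hq) hw2]
  have h3 : (‖x‖ ^ 2) ^ (s - 1) * ‖x‖ ^ 2 = (‖x‖ ^ 2) ^ s := by
    rw [← Real.rpow_add_one hq.ne', sub_add_cancel]
  rw [Real.rpow_add_one hq.ne', ← h3, show (n : ℝ) = -4 * s by rw [hs]; ring]
  ring

lemma continuous_integral_of_isCompact {f : ℝ → ℝ → ℝ} (hf : Continuous (Function.uncurry f))
    {K : Set ℝ} (hK : IsCompact K) (h0 : ∀ ε, ∀ t ∉ K, f ε t = 0) :
    Continuous fun ε => ∫ t, f ε t := by
  refine (continuous_parametric_integral_of_continuous (μ := volume) hf hK).congr fun ε => ?_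
  exact setIntegral_eq_integral_of_forall_compl_eq_zero fun t ht => h0 ε t ht

/-- The Hardy–Rellich type inequality on the sphere obtained from stability by testing with
logarithmic cutoffs of `‖x‖ ^ (-(n - 4) / 2) * w x`. -/
lemma unitSphereInt_stability (hn : 5 ≤ n) {V : 𝔼 → ℝ} {p : ℝ} (hV : ∀ x ≠ 0, ContinuousAt V x)
    (hVd : DegZero fun x => (‖x‖ ^ 2) ^ 2 * V x)
    (hst : ∀ ψ : 𝔼 → ℝ, ContDiff ℝ (⊤ : ℕ∞) ψ → HasCompactSupport ψ → tsupport ψ ⊆ {0}ᶜ →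
      p * ∫ x, V x * ψ x ^ 2 ≤ ∫ x, lap n ψ x ^ 2)
    {w : 𝔼 → ℝ} (hw : DegZero w) (hw2 : ∀ y ≠ 0, ContDiffAt ℝ 2 w y) :
    p * unitSphereInt (fun x => (‖x‖ ^ 2) ^ 2 * V x * w x ^ 2) ≤
      (n * (n - 4) / 4) ^ 2 * unitSphereInt (fun x => w x ^ 2) -
        2 * (n * (n - 4) / 4) * unitSphereInt (fun x => w x * (‖x‖ ^ 2 * lap n w x)) +
          unitSphereInt (fun x => (‖x‖ ^ 2 * lap n w x) ^ 2) := by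
  have hn' : (5 : ℝ) ≤ n := by exact_mod_cast hn
  have hn0 : 0 < n := by omega
  set c : ℝ := n * (n - 4) / 4 with hc
  set L : 𝔼 → ℝ := fun x => ‖x‖ ^ 2 * lap n w x with hL
  have hLd : DegZero L := hw.normSq_mul_lap hw2
  have hLc (x : 𝔼) (hx : x ≠ 0) : ContinuousAt L x := by
    have h : ContinuousAt (lap n w) x :=
      (contDiffAt_lap (k := 0) (m := 2) (by exact_mod_cast hw2 x hx) (by norm_num)).continuousAt
    exact ContinuousAt.mul (by fun_prop) h
  have hwc (x : 𝔼) (hx : x ≠ 0) : ContinuousAt w x := (hw2 x hx).continuousAt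
  set φ : ℝ → ℝ := ⇑lineBump 
  have hφ : ContDiff ℝ 3 φ := lineBump.contDiff
  have hφ1 : ContDiff ℝ 2 (deriv φ) := hφ.deriv'
  have hφ2 : ContDiff ℝ 1 (deriv (deriv φ)) := hφ1.deriv'
  have hφs : HasCompactSupport φ := lineBump.hasCompactSupport
  have hφc := hφ.continuous
  have hφ1c := hφ1.continuous
  have hφ2c := hφ2.continuous
  set α : ℝ → ℝ → ℝ := fun ε t => 4 * ε ^ 2 * deriv (deriv φ) t + 4 * ε * deriv φ t - c * φ t
    with hα
  have hαc (ε : ℝ) : Continuous (α ε) := by fun_prop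
  have hαK (ε t : ℝ) (ht : t ∉ tsupport φ) : α ε t = 0 := by
    have h1 : deriv φ t = 0 := Function.notMem_support.1 fun h => ht (support_deriv_subset h)
    have h2 : deriv (deriv φ) t = 0 := Function.notMem_support.1 fun h =>
      ht (closure_minimal support_deriv_subset (isClosed_tsupport φ) (support_deriv_subset h))
    simp [hα, h1, h2, image_eq_zero_of_notMem_tsupport ht]
  have hαs (ε : ℝ) : HasCompactSupport (α ε) :=
    HasCompactSupport.intro hφs fun t ht => hαK ε t ht
  have hsq {f : ℝ → ℝ} (hf : HasCompactSupport f) : HasCompactSupport fun t => f t ^ 2 :=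
    hf.comp_left (g := fun y => y ^ 2) (by simp)
  have key (ε : ℝ) (hε : 0 < ε) :
      p * ((∫ t, φ t ^ 2) * unitSphereInt (fun x => (‖x‖ ^ 2) ^ 2 * V x * w x ^ 2)) ≤
        (∫ t, α ε t ^ 2) * unitSphereInt (fun x => w x ^ 2) +
        2 * ((∫ t, α ε t * φ t) * unitSphereInt (fun x => w x * L x)) +
        (∫ t, φ t ^ 2) * unitSphereInt (fun x => L x ^ 2) := by
    set ψ : 𝔼 → ℝ := fun y => (‖y‖ ^ 2) ^ (-(n : ℝ) / 4 + 1) * φ (ε * Real.log (‖y‖ ^ 2)) * w y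
      with hψ
    have hs1 : -(n : ℝ) / 4 + 1 ≠ 0 := by linarith
    have hs2 : -(n : ℝ) / 2 ≠ 0 := by linarith
    have hcut := tsupport_log_cutoff (n := n) (hasCompactSupport_comp_const_mul hφs hε) hs1
    have hψs : tsupport ψ ⊆ tsupport fun y : 𝔼 =>
        (‖y‖ ^ 2) ^ (-(n : ℝ) / 4 + 1) * φ (ε * Real.log (‖y‖ ^ 2)) := tsupport_mul_subset_left
    have hψ0 := hψs.trans hcut.2
    have hψc : HasCompactSupport ψ := hcut.1.mul_right
    have hψC : ContDiff ℝ 2 ψ := contDiff_of_contDiffAt_tsupport fun x hx => by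
      have hq := normSq_pos (hψ0 hx)
      have hG : ContDiffAt ℝ 2 (fun t => t ^ (-(n : ℝ) / 4 + 1) * φ (ε * Real.log t)) (‖x‖ ^ 2) :=
        (Real.contDiffAt_rpow_const_of_ne hq.ne').mul
          ((hφ.of_le (by norm_num)).contDiffAt.comp _
            (contDiffAt_const.mul (Real.contDiffAt_log.2 hq.ne')))
      exact contDiffAt_radial_mul hG (hw2 x (hψ0 hx))
    have hcut_int {H : ℝ → ℝ} (hH : HasCompactSupport H) (hHc : Continuous H) {g : 𝔼 → ℝ}
        (hg : ∀ x ≠ 0, ContinuousAt g x) := integrable_scaled_cutoff_mul hH hHc hs2 hε hg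
    have h := stability_of_contDiff_two hV hst hψC hψc hψ0
    have hpow (x : 𝔼) (hx : x ≠ 0) :
        ((‖x‖ ^ 2) ^ (-(n : ℝ) / 4)) ^ 2 = (‖x‖ ^ 2) ^ (-(n : ℝ) / 2) := by
      rw [← Real.rpow_natCast, ← Real.rpow_mul (normSq_pos hx).le]
      congr 1
      push_cast
      ring
    have hl : ∫ x, V x * ψ x ^ 2 = (2 * ε)⁻¹ * (∫ t, φ t ^ 2) *
        unitSphereInt (fun x => (‖x‖ ^ 2) ^ 2 * V x * w x ^ 2) := by
      rw [← integral_scaled_cutoff_mul hn0 (fun t => φ t ^ 2) hε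
        (by simpa only [pow_two (w _)] using hVd.mul (hw.mul hw))]
      refine integral_congr_ae (Eventually.of_forall fun x => ?_)
      by_cases hx : x = 0
      · simp [hψ, hx, Real.zero_rpow hs1, Real.zero_rpow hs2]
      · simp only [hψ]
        rw [← hpow x hx, Real.rpow_add_one (normSq_pos hx).ne']
        ring
    have hr : ∫ x, lap n ψ x ^ 2 = (2 * ε)⁻¹ * (∫ t, α ε t ^ 2) * unitSphereInt (fun x => w x ^ 2) +
        2 * ((2 * ε)⁻¹ * (∫ t, α ε t * φ t) * unitSphereInt (fun x => w x * L x)) +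
        (2 * ε)⁻¹ * (∫ t, φ t ^ 2) * unitSphereInt (fun x => L x ^ 2) := by
      have i1 := hcut_int (hsq (hαs ε)) ((hαc ε).pow 2) (g := fun x => w x ^ 2) fun x hx => (hwc x hx).pow 2
      have i2 := hcut_int (H := fun t => α ε t * φ t) (hαs ε).mul_right ((hαc ε).mul hφc) (g := fun x => w x * L x) fun x hx => (hwc x hx).mul (hLc x hx)
      have i3 := hcut_int (hsq hφs) (hφc.pow 2) (g := fun x => L x ^ 2) fun x hx => (hLc x hx).pow 2
      rw [← integral_scaled_cutoff_mul hn0 (fun t => α ε t ^ 2) hε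
          (by simpa only [pow_two] using hw.mul hw),
        ← integral_scaled_cutoff_mul hn0 (fun t => α ε t * φ t) hε (hw.mul hLd),
        ← integral_scaled_cutoff_mul hn0 (fun t => φ t ^ 2) hε
          (by simpa only [pow_two] using hLd.mul hLd),
        ← integral_const_mul, ← integral_add i1 (i2.const_mul 2)]
      have : NeZero n := ⟨hn0.ne'⟩
      refine Eq.trans (integral_congr_ae ?_) (integral_add (i1.add (i2.const_mul 2)) i3)
      filter_upwards [compl_mem_ae_iff.2 (measure_singleton (0 : 𝔼))] with x hx
      rw [hψ, lap_scaled_cutoff_mul (hφ.of_le (by norm_num))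
        (fun t => (hφ.differentiable (by norm_num) t).hasDerivAt)
        (fun t => (hφ1.differentiable (by norm_num) t).hasDerivAt) ε hw hw2 hx, mul_pow, hpow x hx]
      simp only [hα, hL, hc]
      ring
    rw [hl, hr] at h
    have hε2 : 0 < 2 * ε := by positivity
    have h' := mul_le_mul_of_nonneg_left h hε2.le
    have e : 2 * ε * (2 * ε)⁻¹ = 1 := mul_inv_cancel₀ hε2.ne'
    linear_combination h' - (p * ((∫ t, φ t ^ 2) *
        unitSphereInt (fun x => (‖x‖ ^ 2) ^ 2 * V x * w x ^ 2)) -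
        ((∫ t, α ε t ^ 2) * unitSphereInt (fun x => w x ^ 2) +
        2 * ((∫ t, α ε t * φ t) * unitSphereInt (fun x => w x * L x)) +
        (∫ t, φ t ^ 2) * unitSphereInt (fun x => L x ^ 2))) * e
  have hc1 : Continuous fun ε => ∫ t, α ε t ^ 2 :=
    continuous_integral_of_isCompact (by simp only [hα, Function.uncurry_def]; fun_prop) hφs
      fun ε t ht => by simp [hαK ε t ht]
  have hc2 : Continuous fun ε => ∫ t, α ε t * φ t :=
    continuous_integral_of_isCompact (by simp only [hα, Function.uncurry_def]; fun_prop) hφs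
      fun ε t ht => by simp [hαK ε t ht]
  have hlim := ((hc1.mul_const (unitSphereInt fun x => w x ^ 2)).add
    ((hc2.mul_const (unitSphereInt fun x => w x * L x)).const_mul 2)).add_const
      ((∫ t, φ t ^ 2) * unitSphereInt fun x => L x ^ 2)
  have hle := ge_of_tendsto ((hlim.tendsto 0).mono_left nhdsWithin_le_nhds)
    (eventually_mem_nhdsWithin.mono key : ∀ᶠ ε in 𝓝[>] (0 : ℝ), _)
  have e1 : ∫ t, α 0 t ^ 2 = c ^ 2 * ∫ t, φ t ^ 2 := by
    rw [← integral_const_mul]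
    simp [hα, mul_pow]
  have e2 : ∫ t, α 0 t * φ t = -c * ∫ t, φ t ^ 2 := by
    rw [← integral_const_mul]
    congr 1
    ext t
    simp only [hα]
    ring
  have hpos : 0 < ∫ t, φ t ^ 2 :=
    (hφc.pow 2).integral_pos_of_hasCompactSupport_nonneg_nonzero
      (hsq hφs) (fun t => sq_nonneg _) (x := 0)
      (pow_ne_zero 2 (lineBump.pos_of_mem_ball (mem_ball_self lineBump.rOut_pos)).ne')
  simp only [Pi.add_apply, e1, e2] at hle
  refine le_of_mul_le_mul_left ?_ hpos
  linear_combination hle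

end Stability

section Homogeneous

variable {n : ℕ}

local notation "𝔼" => EuclideanSpace ℝ (Fin n)

lemma unitSphereInt_sub_add {f g h : 𝔼 → ℝ} (hf : ∀ x ≠ 0, ContinuousAt f x)
    (hg : ∀ x ≠ 0, ContinuousAt g x) (hh : ∀ x ≠ 0, ContinuousAt h x) (b c : ℝ) :
    unitSphereInt (fun x => f x - b * g x + c * h x) =
      unitSphereInt f - b * unitSphereInt g + c * unitSphereInt h := by
  have hf' := integrable_sphere hf
  have hg' := (integrable_sphere hg).const_mul b
  have hh' := (integrable_sphere hh).const_mul c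
  unfold unitSphereInt
  rw [← integral_const_mul, ← integral_const_mul, ← integral_sub hf' hg']
  exact integral_add (hf'.sub hg') hh'

lemma degZero_rpow_mul {u : 𝔼 → ℝ} {β : ℝ}
    (hu : ∀ τ : ℝ, 0 < τ → ∀ x : 𝔼, x ≠ 0 → u (τ • x) = τ ^ (-β) * u x) :
    DegZero fun x => (‖x‖ ^ 2) ^ (β / 2) * u x := fun τ hτ x hx => by
  have h : (τ ^ 2) ^ (β / 2) * τ ^ (-β) = 1 := by
    rw [← Real.rpow_natCast, ← Real.rpow_mul hτ.le, ← Real.rpow_add hτ]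
    rw [show ((2 : ℕ) : ℝ) * (β / 2) + -β = 0 by push_cast; ring, Real.rpow_zero]
  simp only [hu τ hτ x hx, norm_smul, Real.norm_eq_abs, mul_pow, sq_abs]
  rw [Real.mul_rpow (by positivity) (by positivity)]
  linear_combination ((‖x‖ ^ 2) ^ (β / 2) * u x) * h

lemma degZero_potential {u : 𝔼 → ℝ} {a p β : ℝ} (hβ : β * (p - 1) = 4 + a)
    (hu : ∀ τ : ℝ, 0 < τ → ∀ x : 𝔼, x ≠ 0 → u (τ • x) = τ ^ (-β) * u x) :
    DegZero fun x => (‖x‖ ^ 2) ^ 2 * (‖x‖ ^ a * |u x| ^ (p - 1)) := fun τ hτ x hx => by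
  have h : τ ^ 4 * τ ^ a * (τ ^ (-β)) ^ (p - 1) = 1 := by
    rw [← Real.rpow_natCast, ← Real.rpow_mul hτ.le, ← Real.rpow_add hτ, ← Real.rpow_add hτ,
      show ((4 : ℕ) : ℝ) + a + -β * (p - 1) = 0 by push_cast; linarith, Real.rpow_zero]
  simp only [hu τ hτ x hx, norm_smul, Real.norm_eq_abs, abs_mul, abs_of_pos hτ,
    abs_of_pos (Real.rpow_pos_of_pos hτ (-β))]
  rw [Real.mul_rpow hτ.le (norm_nonneg x),
    Real.mul_rpow (Real.rpow_pos_of_pos hτ (-β)).le (abs_nonneg _)]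
  linear_combination ((‖x‖ ^ 2) ^ 2 * (‖x‖ ^ a * |u x| ^ (p - 1))) * h

lemma lap_rpow_mul_of_eq {f g : 𝔼 → ℝ} (hg : DegZero g) (hg2 : ∀ y ≠ 0, ContDiffAt ℝ 2 g y) {s : ℝ}
    (hfg : ∀ x ≠ 0, f x = (‖x‖ ^ 2) ^ s * g x) {x : 𝔼} (hx : x ≠ 0) :
    lap n f x =
      (‖x‖ ^ 2) ^ (s - 1) * (‖x‖ ^ 2 * lap n g x + 2 * s * (2 * s + n - 2) * g x) := by
  rw [← lap_rpow_mul hg hg2 s hx]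
  exact lap_congr ((eventually_ne_nhds hx).mono hfg)

/-- The equation of the angular part of a homogeneous function with prescribed bilaplacian. -/
lemma lap_lap_eq_on_sphere {u w : 𝔼 → ℝ} {β : ℝ} (hw : DegZero w)
    (hw4 : ∀ y ≠ 0, ContDiffAt ℝ 4 w y) (huw : ∀ x ≠ 0, u x = (‖x‖ ^ 2) ^ (-(β / 2)) * w x) {x : 𝔼}
    (hx : ‖x‖ = 1) :
    lap n (lap n u) x = ‖x‖ ^ 2 * lap n (fun y => ‖y‖ ^ 2 * lap n w y) x -
      ((β + 2) * (n - 4 - β) + β * (n - 2 - β)) * (‖x‖ ^ 2 * lap n w x) +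
        β * (β + 2) * (n - 4 - β) * (n - 2 - β) * w x := by
  have hx0 : x ≠ 0 := by
    rintro rfl
    simp at hx
  have hw2 (y : 𝔼) (hy : y ≠ 0) : ContDiffAt ℝ 2 w y := (hw4 y hy).of_le (by norm_num)
  set L : 𝔼 → ℝ := fun y => ‖y‖ ^ 2 * lap n w y with hL
  have hLd : DegZero L := hw.normSq_mul_lap hw2
  have hL2 (y : 𝔼) (hy : y ≠ 0) : ContDiffAt ℝ 2 L y := by
    have h : ContDiffAt ℝ 2 (lap n w) y := by
      exact_mod_cast contDiffAt_lap (k := 2) (m := 4) (by exact_mod_cast hw4 y hy) le_rfl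
    exact (contDiff_norm_sq ℝ).contDiffAt.mul h
  have hMd : DegZero fun y => L y - β * (n - 2 - β) * w y := fun τ hτ y hy => by
    simp only [hLd τ hτ y hy, hw τ hτ y hy]
  have hM2 (y : 𝔼) (hy : y ≠ 0) : ContDiffAt ℝ 2 (fun y => L y - β * (n - 2 - β) * w y) y :=
    (hL2 y hy).sub (contDiffAt_const.mul (hw2 y hy))
  rw [lap_rpow_mul_of_eq hMd hM2 (fun y hy => ?_) hx0 (s := -(β / 2) - 1),
    lap_sub_const_mul _ (hL2 x hx0) (hw2 x hx0)]
  · simp only [hL, hx]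
    simp only [one_pow, Real.one_rpow]
    ring
  · rw [lap_rpow_mul_of_eq hw hw2 huw hy]
    ring

end Homogeneous

/-- Theorem 3.1: nonexistence of nontrivial homogeneous stable
solutions on `ℝⁿ \ {0}` in the supercritical range `(n+4+2a)/(n-4) < p < p_a(n)`. -/
theorem stmt9 (n : ℕ) (hn : 5 ≤ n) (a p : ℝ) (ha : 0 ≤ a)
    (hpc : ((n : ℝ) + 4 + 2 * a) / ((n : ℝ) - 4) < p)
    (hl1 : p * ell1 n a p > (n : ℝ) * ((n : ℝ) - 4) / 2)
    (hl2 : p * ell2 n a p > (n : ℝ) ^ 2 * ((n : ℝ) - 4) ^ 2 / 16)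
    (u : EuclideanSpace ℝ (Fin n) → ℝ)
    (hu : ContDiffOn ℝ 4 u ({0}ᶜ : Set (EuclideanSpace ℝ (Fin n))))
    (hsol : IsSolutionOn n a p u ({0}ᶜ : Set (EuclideanSpace ℝ (Fin n))))
    (hstab : StableOn n a p u ({0}ᶜ : Set (EuclideanSpace ℝ (Fin n))))
    (hhom : ∀ τ : ℝ, 0 < τ → ∀ x : EuclideanSpace ℝ (Fin n), x ≠ 0 →
      u (τ • x) = τ ^ (-((4 + a) / (p - 1))) * u x) :
    ∀ x : EuclideanSpace ℝ (Fin n), x ≠ 0 → u x = 0 := by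
  have hn' : (5 : ℝ) ≤ n := by exact_mod_cast hn
  have hp : 1 < p := by
    refine lt_of_le_of_lt ?_ hpc
    rw [le_div_iff₀ (by linarith)]
    linarith
  unfold ell1 at hl1
  unfold ell2 at hl2
  set β : ℝ := (4 + a) / (p - 1)
  simp only at hl1 hl2
  have hβ : β * (p - 1) = 4 + a := div_mul_cancel₀ _ (by linarith)
  have hu4 (x : EuclideanSpace ℝ (Fin n)) (hx : x ≠ 0) : ContDiffAt ℝ 4 u x :=
    hu.contDiffAt (isOpen_compl_singleton.mem_nhds hx)
  set w : EuclideanSpace ℝ (Fin n) → ℝ := fun x => (‖x‖ ^ 2) ^ (β / 2) * u x with hw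
  have hwd : DegZero w := degZero_rpow_mul hhom
  have hw4 (x : EuclideanSpace ℝ (Fin n)) (hx : x ≠ 0) : ContDiffAt ℝ 4 w x :=
    ((contDiff_norm_sq ℝ).contDiffAt.rpow_const_of_ne (normSq_pos hx).ne').mul (hu4 x hx)
  have hw2 (x : EuclideanSpace ℝ (Fin n)) (hx : x ≠ 0) : ContDiffAt ℝ 2 w x :=
    (hw4 x hx).of_le (by norm_num)
  have huw (x : EuclideanSpace ℝ (Fin n)) (hx : x ≠ 0) :
      u x = (‖x‖ ^ 2) ^ (-(β / 2)) * w x := by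
    rw [hw, ← mul_assoc, ← Real.rpow_add (normSq_pos hx), neg_add_cancel, Real.rpow_zero, one_mul]
  set L : EuclideanSpace ℝ (Fin n) → ℝ := fun x => ‖x‖ ^ 2 * lap n w x with hL
  have hLd : DegZero L := hwd.normSq_mul_lap hw2
  have hL2 (x : EuclideanSpace ℝ (Fin n)) (hx : x ≠ 0) : ContDiffAt ℝ 2 L x := by
    have h : ContDiffAt ℝ 2 (lap n w) x := by
      exact_mod_cast contDiffAt_lap (k := 2) (m := 4) (by exact_mod_cast hw4 x hx) le_rfl
    exact (contDiff_norm_sq ℝ).contDiffAt.mul h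
  have hV (x : EuclideanSpace ℝ (Fin n)) (hx : x ≠ 0) :
      ContinuousAt (fun x => ‖x‖ ^ a * |u x| ^ (p - 1)) x :=
    (continuousAt_id.norm.rpow_const (Or.inl (norm_ne_zero_iff.2 hx))).mul
      ((hu4 x hx).continuousAt.abs.rpow_const (Or.inr (by linarith)))
  have hmain : p * unitSphereInt (fun x => (‖x‖ ^ 2) ^ 2 * (‖x‖ ^ a * |u x| ^ (p - 1)) * w x ^ 2) ≤
      (n * (n - 4) / 4) ^ 2 * unitSphereInt (fun x => w x ^ 2) -
        2 * (n * (n - 4) / 4) * unitSphereInt (fun x => w x * L x) +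
          unitSphereInt (fun x => L x ^ 2) :=
    unitSphereInt_stability hn hV (degZero_potential hβ hhom) hstab hwd hw2
  have hE : unitSphereInt (fun x => (‖x‖ ^ 2) ^ 2 * (‖x‖ ^ a * |u x| ^ (p - 1)) * w x ^ 2) =
      unitSphereInt (fun x => w x * (‖x‖ ^ 2 * lap n L x)) -
        ((β + 2) * (n - 4 - β) + β * (n - 2 - β)) * unitSphereInt (fun x => w x * L x) +
          β * (β + 2) * (n - 4 - β) * (n - 2 - β) * unitSphereInt (fun x => w x ^ 2) := by
    rw [← unitSphereInt_sub_add]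
    · refine unitSphereInt_congr fun x hx => ?_
      have hx0 : x ≠ 0 := by
        rintro rfl
        simp at hx
      have h := lap_lap_eq_on_sphere hwd hw4 huw hx
      rw [hsol x hx0] at h
      have hu1 : u x = w x := by simp [hw, hx]
      rw [hu1] at h ⊢
      simp only [hL, hx, one_pow, Real.one_rpow, one_mul] at h ⊢
      linear_combination w x * h
    · intro x hx
      have h : ContinuousAt (lap n L) x :=
        (contDiffAt_lap (k := 0) (m := 2) (by exact_mod_cast hL2 x hx) (by norm_num)).continuousAt
      exact (hw2 x hx).continuousAt.mul (continuousAt_id.norm.pow 2 |>.mul h)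
    · exact fun x hx => (hw2 x hx).continuousAt.mul (hL2 x hx).continuousAt
    · exact fun x hx => (hw2 x hx).continuousAt.pow 2
  have hD : unitSphereInt (fun x => w x * (‖x‖ ^ 2 * lap n L x)) =
      unitSphereInt (fun x => L x ^ 2) := by
    rw [unitSphereInt_mul_lap_comm hn hwd hLd hw2 hL2]
    simp only [hL, pow_two (‖_‖ ^ 2 * _)]
  have hB : unitSphereInt (fun x => w x * L x) ≤ 0 := unitSphereInt_mul_lap_self_nonpos hn hwd hw2
  have hD0 : 0 ≤ unitSphereInt fun x => L x ^ 2 := integral_nonneg fun _ => sq_nonneg _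
  rw [hE, hD] at hmain
  have hA : unitSphereInt (fun x => w x ^ 2) ≤ 0 := by
    by_contra! hpos
    have h1 := mul_pos (sub_pos.2 hl2) hpos
    have h2 := mul_nonneg (sub_pos.2 hl1).le (neg_nonneg.2 hB)
    have h3 := mul_nonneg (sub_pos.2 hp).le hD0
    linarith
  intro x hx
  rw [huw x hx, eq_zero_of_unitSphereInt_sq_nonpos (fun y hy => (hw2 y hy).continuousAt) hwd hA x hx,
    mul_zero]
end

section
/- Let n ≥ 5, a ≥ 0 and p > 1 with β = (4+a)/(p-1) < n − 4, and let u_s(x) = ℓ₂^{1/(p-1)} |x|^{−β}, where ℓ₂ = β(β+2)(n-4-β)(n-2-β) > 0. Then u_s is a stable solution of Δ²u = |x|^a |u|^{p-1} u on ℝ^n \ {0}, i.e. p ∫ |x|^a u_s(x)^{p-1} ψ(x)² dx ≤ ∫ (Δψ(x))² dx for all ψ ∈ C_c^∞(ℝ^n \ {0}), if and only if p·ℓ₂ ≤ n²(n-4)²/16. -/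
open MeasureTheory Metric Set Filter
open scoped RealInnerProductSpace Topology

section EuclideanCalculus

variable {n : ℕ}

local notation "𝔼" => EuclideanSpace ℝ (Fin n)

/-- The partial derivative of `u` in the `i`-th coordinate direction. -/
noncomputable def partialDeriv (i : Fin n) (u : 𝔼 → ℝ) (x : 𝔼) : ℝ :=
  fderiv ℝ u x (EuclideanSpace.single i 1)

theorem contDiff_of_contDiffAt_tsupport_s11 {u : 𝔼 → ℝ}
    (h : ∀ x ∈ tsupport u, ContDiffAt ℝ (⊤ : ℕ∞) u x) : ContDiff ℝ (⊤ : ℕ∞) u := by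
  refine contDiff_iff_contDiffAt.2 fun x => ?_
  by_cases hx : x ∈ tsupport u
  · exact h x hx
  · exact (contDiffAt_const (c := (0 : ℝ))).congr_of_eventuallyEq
      (notMem_tsupport_iff_eventuallyEq.1 hx)

theorem contDiff_partialDeriv (i : Fin n) {u : 𝔼 → ℝ} (hu : ContDiff ℝ (⊤ : ℕ∞) u) :
    ContDiff ℝ (⊤ : ℕ∞) (partialDeriv i u) :=
  (hu.fderiv_right (m := (⊤ : ℕ∞)) (by simp)).clm_apply contDiff_const

theorem tsupport_partialDeriv_subset (i : Fin n) (u : 𝔼 → ℝ) :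
    tsupport (partialDeriv i u) ⊆ tsupport u :=
  tsupport_fderiv_apply_subset ℝ (EuclideanSpace.single i (1 : ℝ))

theorem hasLineDerivAt_partialDeriv (i : Fin n) {u : 𝔼 → ℝ} {x : 𝔼}
    (hu : DifferentiableAt ℝ u x) :
    HasLineDerivAt ℝ u (partialDeriv i u x) x (EuclideanSpace.single i 1) :=
  hu.hasFDerivAt.hasLineDerivAt _

theorem HasLineDerivAt.partialDeriv_eq {i : Fin n} {u : 𝔼 → ℝ} {x : 𝔼} {d : ℝ}
    (h : HasLineDerivAt ℝ u d x (EuclideanSpace.single i 1)) (hu : DifferentiableAt ℝ u x) :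
    partialDeriv i u x = d :=
  (hasLineDerivAt_partialDeriv i hu).unique h

theorem lap_eq_sum_partialDeriv {u : 𝔼 → ℝ} (hu : ContDiff ℝ (⊤ : ℕ∞) u) (x : 𝔼) :
    lap n u x = ∑ i, partialDeriv i (partialDeriv i u) x := by
  refine Finset.sum_congr rfl fun i _ => ?_
  have hd : DifferentiableAt ℝ (fderiv ℝ u) x :=
    ((hu.fderiv_right (m := (⊤ : ℕ∞)) (by simp)).differentiable (by simp)) x
  rw [iteratedFDeriv_two_apply]
  change _ = fderiv ℝ (fun y => fderiv ℝ u y (EuclideanSpace.single i 1)) x _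
  rw [fderiv_clm_apply hd (differentiableAt_const _)]
  simp

theorem hasLineDerivAt_norm_sq (x : 𝔼) (i : Fin n) :
    HasLineDerivAt ℝ (fun y : 𝔼 => ‖y‖ ^ 2) (2 * x i) x (EuclideanSpace.single i 1) := by
  have h := (hasStrictFDerivAt_norm_sq x).hasFDerivAt.hasLineDerivAt (EuclideanSpace.single i 1)
  simpa [EuclideanSpace.inner_single_right] using h

theorem hasLineDerivAt_coord (x : 𝔼) (i : Fin n) :
    HasLineDerivAt ℝ (fun y : 𝔼 => y i) 1 x (EuclideanSpace.single i 1) := by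
  have h := (EuclideanSpace.proj (𝕜 := ℝ) i : 𝔼 →L[ℝ] ℝ).hasFDerivAt (x := x)
    |>.hasLineDerivAt (EuclideanSpace.single i 1)
  simpa using h

theorem hasLineDerivAt_inv_norm_sq (i : Fin n) {x : 𝔼} (hx : x ≠ 0) :
    HasLineDerivAt ℝ (fun y : 𝔼 => (‖y‖ ^ 2)⁻¹) (-(2 * x i) / (‖x‖ ^ 2) ^ 2) x
      (EuclideanSpace.single i 1) := by
  have h := HasDerivAt.inv (hasLineDerivAt_norm_sq x i) (by simpa using hx)
  simp only [zero_smul, add_zero] at h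
  exact h

theorem integral_partialDeriv_eq_zero (i : Fin n) {u : 𝔼 → ℝ} (hu : ContDiff ℝ (⊤ : ℕ∞) u)
    (hc : HasCompactSupport u) : ∫ x, partialDeriv i u x = 0 := by
  have h := integral_mul_fderiv_eq_neg_fderiv_mul_of_integrable (μ := (volume : Measure 𝔼))
    (f := fun _ => (1 : ℝ)) (g := u) (v := EuclideanSpace.single i 1) (by simp)
    (by
      simp only [one_mul]
      exact (contDiff_partialDeriv i hu).continuous.integrable_of_hasCompactSupport
        (hc.mono' ((subset_tsupport _).trans (tsupport_partialDeriv_subset i u))))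
    (by simpa using hu.continuous.integrable_of_hasCompactSupport hc)
    (fun x _ => differentiableAt_const _) (fun x _ => hu.differentiable (by simp) x)
  simpa [partialDeriv] using h

end EuclideanCalculus

section Rellich

variable {n : ℕ}

local notation "𝔼" => EuclideanSpace ℝ (Fin n)

/-- The vector field whose divergence links `(Δψ)²` with `ψ² / |x|⁴` in Rellich's inequality. -/
noncomputable def rellichField (ψ : 𝔼 → ℝ) (i : Fin n) (x : 𝔼) : ℝ :=
  ψ x * partialDeriv i ψ x * (‖x‖ ^ 2)⁻¹ + ((n : ℝ) - 2) / 2 * (ψ x ^ 2 * x i * ((‖x‖ ^ 2)⁻¹) ^ 2)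

theorem tsupport_rellichField_subset (ψ : 𝔼 → ℝ) (i : Fin n) :
    tsupport (rellichField ψ i) ⊆ tsupport ψ := by
  refine closure_mono fun x hx => ?_
  contrapose! hx
  simp only [Function.mem_support, not_not] at hx ⊢
  simp [rellichField, hx]

theorem contDiffAt_inv_norm_sq {x : 𝔼} (hx : x ≠ 0) :
    ContDiffAt ℝ (⊤ : ℕ∞) (fun y : 𝔼 => (‖y‖ ^ 2)⁻¹) x :=
  (contDiff_norm_sq ℝ).contDiffAt.inv (by simpa using hx)

theorem contDiff_rellichField {ψ : 𝔼 → ℝ} (hψ : ContDiff ℝ (⊤ : ℕ∞) ψ)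
    (h0 : tsupport ψ ⊆ ({0}ᶜ : Set 𝔼)) (i : Fin n) :
    ContDiff ℝ (⊤ : ℕ∞) (rellichField ψ i) := by
  refine contDiff_of_contDiffAt_tsupport_s11 fun x hx => ?_
  have hq := contDiffAt_inv_norm_sq (h0 (tsupport_rellichField_subset ψ i hx))
  have hd := (contDiff_partialDeriv i hψ).contDiffAt (x := x)
  have hi : ContDiffAt ℝ (⊤ : ℕ∞) (fun y : 𝔼 => y i) x :=
    (EuclideanSpace.proj (𝕜 := ℝ) i : 𝔼 →L[ℝ] ℝ).contDiff.contDiffAt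
  exact ((hψ.contDiffAt.mul hd).mul hq).add
    (contDiffAt_const.mul (((hψ.contDiffAt.pow 2).mul hi).mul (hq.pow 2)))

theorem partialDeriv_rellichField {ψ : 𝔼 → ℝ} (hψ : ContDiff ℝ (⊤ : ℕ∞) ψ)
    (h0 : tsupport ψ ⊆ ({0}ᶜ : Set 𝔼)) (i : Fin n) {x : 𝔼} (hx : x ≠ 0) :
    partialDeriv i (rellichField ψ i) x =
      partialDeriv i ψ x ^ 2 / ‖x‖ ^ 2 + ψ x * partialDeriv i (partialDeriv i ψ) x / ‖x‖ ^ 2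
        + ((n : ℝ) - 4) * ψ x * (partialDeriv i ψ x * x i) / (‖x‖ ^ 2) ^ 2
        + ((n : ℝ) - 2) / 2 * (ψ x ^ 2 / (‖x‖ ^ 2) ^ 2
          - 4 * ψ x ^ 2 * x i ^ 2 / (‖x‖ ^ 2) ^ 3) := by
  have hr : ‖x‖ ^ 2 ≠ 0 := by simpa using hx
  have hu := hasLineDerivAt_partialDeriv i (hψ.differentiable (by simp) x)
  have hd := hasLineDerivAt_partialDeriv i ((contDiff_partialDeriv i hψ).differentiable (by simp) x)
  have hq := hasLineDerivAt_inv_norm_sq i hx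
  have hi := hasLineDerivAt_coord x i
  have key : HasLineDerivAt ℝ (rellichField ψ i) _ x (EuclideanSpace.single i 1) :=
    HasDerivAt.add (HasDerivAt.mul (HasDerivAt.mul hu hd) hq)
      (HasDerivAt.const_mul (((n : ℝ) - 2) / 2)
        (HasDerivAt.mul (HasDerivAt.mul (HasDerivAt.pow hu 2) hi) (HasDerivAt.pow hq 2)))
  rw [key.partialDeriv_eq ((contDiff_rellichField hψ h0 i).differentiable (by simp) x)]
  simp only [zero_smul, add_zero, Nat.reduceSub, pow_one, Nat.cast_ofNat]
  field_simp
  ring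

theorem rellich_pointwise {ψ : 𝔼 → ℝ} (hn : 4 ≤ n) (hψ : ContDiff ℝ (⊤ : ℕ∞) ψ)
    (h0 : tsupport ψ ⊆ ({0}ᶜ : Set 𝔼)) {x : 𝔼} (hx : x ≠ 0) :
    (n : ℝ) ^ 2 * ((n : ℝ) - 4) ^ 2 / 16 * (ψ x ^ 2 * ((‖x‖ ^ 2)⁻¹) ^ 2) ≤
      lap n ψ x ^ 2
        + n * ((n : ℝ) - 4) / 2 * ∑ i, partialDeriv i (rellichField ψ i) x := by
  have hr : 0 < ‖x‖ ^ 2 := by positivity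
  have hn' : (4 : ℝ) ≤ n := by exact_mod_cast hn
  have hsum : ∑ i, x i ^ 2 = ‖x‖ ^ 2 := by
    simp [EuclideanSpace.norm_sq_eq]
  have hsq : 0 ≤ ∑ i, (partialDeriv i ψ x + ((n : ℝ) - 4) / 2 * ψ x * x i / ‖x‖ ^ 2) ^ 2 :=
    Finset.sum_nonneg fun i _ => sq_nonneg _
  have hexp : ∑ i, (partialDeriv i ψ x + ((n : ℝ) - 4) / 2 * ψ x * x i / ‖x‖ ^ 2) ^ 2 =
      ∑ i, partialDeriv i ψ x ^ 2
        + ((n : ℝ) - 4) * ψ x / ‖x‖ ^ 2 * ∑ i, partialDeriv i ψ x * x i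
        + (((n : ℝ) - 4) / 2) ^ 2 * ψ x ^ 2 / (‖x‖ ^ 2) ^ 2 * ∑ i, x i ^ 2 := by
    simp only [Finset.mul_sum, ← Finset.sum_add_distrib]
    exact Finset.sum_congr rfl fun i _ => by field_simp; ring
  have hdiv : ∑ i, partialDeriv i (rellichField ψ i) x =
      (∑ i, partialDeriv i ψ x ^ 2) / ‖x‖ ^ 2 + ψ x * lap n ψ x / ‖x‖ ^ 2
        + ((n : ℝ) - 4) * ψ x * (∑ i, partialDeriv i ψ x * x i) / (‖x‖ ^ 2) ^ 2
        + ((n : ℝ) - 2) / 2 * (n * (ψ x ^ 2 / (‖x‖ ^ 2) ^ 2)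
          - 4 * ψ x ^ 2 * (∑ i, x i ^ 2) / (‖x‖ ^ 2) ^ 3) := by
    simp only [lap_eq_sum_partialDeriv hψ, partialDeriv_rellichField hψ h0 _ hx,
      Finset.sum_add_distrib, Finset.mul_sum, Finset.sum_div]
    simp [← Finset.mul_sum, ← Finset.sum_div, Finset.sum_sub_distrib]
  rw [hexp, hsum] at hsq
  rw [hdiv, hsum]
  generalize ∑ i, partialDeriv i ψ x ^ 2 = S at *
  generalize ∑ i, partialDeriv i ψ x * x i = T at *
  generalize lap n ψ x = L at *
  generalize ψ x = u at *
  generalize ‖x‖ ^ 2 = R at *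
  have h1 : 0 ≤ (n : ℝ) * (n - 4) / 2 * ((S + ((n : ℝ) - 4) * u / R * T
      + (((n : ℝ) - 4) / 2) ^ 2 * u ^ 2 / R ^ 2 * R) / R) := by
    have : (0 : ℝ) ≤ (n : ℝ) - 4 := by linarith
    positivity
  have h2 := sq_nonneg (L + n * ((n : ℝ) - 4) / 4 * u / R)
  rw [← sub_nonneg]
  refine (add_nonneg h1 h2).trans_eq ?_
  field_simp
  ring

theorem integrable_lap_sq {ψ : 𝔼 → ℝ} (hψ : ContDiff ℝ (⊤ : ℕ∞) ψ) (hc : HasCompactSupport ψ) :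
    Integrable fun x => lap n ψ x ^ 2 := by
  simp only [lap_eq_sum_partialDeriv hψ]
  refine Continuous.integrable_of_hasCompactSupport ?_ ?_
  · exact (continuous_finsetSum _ fun i _ =>
      (contDiff_partialDeriv i (contDiff_partialDeriv i hψ)).continuous).pow 2
  · refine hc.mono' fun x hx => ?_
    contrapose! hx
    have : ∀ i, partialDeriv i (partialDeriv i ψ) x = 0 := fun i =>
      image_eq_zero_of_notMem_tsupport fun h =>
        hx (tsupport_partialDeriv_subset i ψ (tsupport_partialDeriv_subset i _ h))
    simp [this]

theorem integrable_sq_mul_inv_norm_pow {ψ : 𝔼 → ℝ} (hψ : ContDiff ℝ (⊤ : ℕ∞) ψ)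
    (hc : HasCompactSupport ψ) (h0 : tsupport ψ ⊆ ({0}ᶜ : Set 𝔼)) :
    Integrable fun x => ψ x ^ 2 * ((‖x‖ ^ 2)⁻¹) ^ 2 := by
  have hs : tsupport (fun x => ψ x ^ 2 * ((‖x‖ ^ 2)⁻¹) ^ 2) ⊆ tsupport ψ := by
    refine closure_mono fun x hx => ?_
    contrapose! hx
    simp only [Function.mem_support, not_not] at hx ⊢
    simp [hx]
  refine Continuous.integrable_of_hasCompactSupport ?_ (hc.mono' ((subset_tsupport _).trans hs))
  exact (contDiff_of_contDiffAt_tsupport_s11 fun x hx => (hψ.contDiffAt.pow 2).mul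
    ((contDiffAt_inv_norm_sq (h0 (hs hx))).pow 2)).continuous

/-- **Rellich's inequality** for test functions supported away from the origin. -/
theorem rellich_inequality {ψ : 𝔼 → ℝ} (hn : 4 ≤ n) (hψ : ContDiff ℝ (⊤ : ℕ∞) ψ)
    (hc : HasCompactSupport ψ) (h0 : tsupport ψ ⊆ ({0}ᶜ : Set 𝔼)) :
    (n : ℝ) ^ 2 * ((n : ℝ) - 4) ^ 2 / 16 * ∫ x, ψ x ^ 2 * ((‖x‖ ^ 2)⁻¹) ^ 2 ≤
      ∫ x, lap n ψ x ^ 2 := by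
  have : Nonempty (Fin n) := ⟨⟨0, by omega⟩⟩
  have hcF (i : Fin n) : HasCompactSupport (rellichField ψ i) :=
    hc.mono' ((subset_tsupport _).trans (tsupport_rellichField_subset ψ i))
  have hF (i : Fin n) : Integrable (partialDeriv i (rellichField ψ i)) :=
    (contDiff_partialDeriv i (contDiff_rellichField hψ h0 i)).continuous
      |>.integrable_of_hasCompactSupport ((hcF i).mono' ((subset_tsupport _).trans
        (tsupport_partialDeriv_subset i _)))
  have hdiv : Integrable fun x => n * ((n : ℝ) - 4) / 2 *
      ∑ i, partialDeriv i (rellichField ψ i) x :=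
    (integrable_finsetSum _ fun i _ => hF i).const_mul _
  calc _ = ∫ x, (n : ℝ) ^ 2 * ((n : ℝ) - 4) ^ 2 / 16 * (ψ x ^ 2 * ((‖x‖ ^ 2)⁻¹) ^ 2) :=
        (integral_const_mul _ _).symm
    _ ≤ ∫ x, (lap n ψ x ^ 2
        + n * ((n : ℝ) - 4) / 2 * ∑ i, partialDeriv i (rellichField ψ i) x) := by
      refine integral_mono_ae ((integrable_sq_mul_inv_norm_pow hψ hc h0).const_mul _)
        ((integrable_lap_sq hψ hc).add hdiv) ?_
      filter_upwards [compl_mem_ae_iff.2 (measure_singleton (0 : 𝔼))] with x hx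
      exact rellich_pointwise hn hψ h0 hx
    _ = ∫ x, lap n ψ x ^ 2 := by
      rw [integral_add (integrable_lap_sq hψ hc) hdiv, integral_const_mul,
        integral_finsetSum _ fun i _ => hF i]
      simp [integral_partialDeriv_eq_zero _ (contDiff_rellichField hψ h0 _) (hcF _)]

end Rellich

section Sharpness

variable {n : ℕ}

local notation "𝔼" => EuclideanSpace ℝ (Fin n)

theorem hasLineDerivAt_comp_log_norm_sq {k : ℝ → ℝ} (hk : Differentiable ℝ k) (i : Fin n) {x : 𝔼}
    (hx : x ≠ 0) :
    HasLineDerivAt ℝ (fun y : 𝔼 => k (Real.log (‖y‖ ^ 2)))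
      (deriv k (Real.log (‖x‖ ^ 2)) * (2 * x i / ‖x‖ ^ 2)) x (EuclideanSpace.single i 1) := by
  have hlog := HasDerivAt.log (hasLineDerivAt_norm_sq x i) (by simpa using hx)
  have h := (hk (Real.log (‖x + (0 : ℝ) • EuclideanSpace.single i (1 : ℝ)‖ ^ 2))).hasDerivAt.comp
    (0 : ℝ) hlog
  simp only [zero_smul, add_zero] at h
  exact h

theorem lap_comp_log_norm_sq {k : ℝ → ℝ} (hk : ContDiff ℝ (⊤ : ℕ∞) k)
    (hψ : ContDiff ℝ (⊤ : ℕ∞) fun y : 𝔼 => k (Real.log (‖y‖ ^ 2))) {x : 𝔼} (hx : x ≠ 0) :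
    lap n (fun y => k (Real.log (‖y‖ ^ 2))) x =
      (4 * deriv (deriv k) (Real.log (‖x‖ ^ 2))
        + (2 * n - 4) * deriv k (Real.log (‖x‖ ^ 2))) / ‖x‖ ^ 2 := by
  have hr : ‖x‖ ^ 2 ≠ 0 := by simpa using hx
  have hk' : ContDiff ℝ (⊤ : ℕ∞) (deriv k) := (contDiff_infty_iff_deriv.1 hk).2
  have hsum : ∑ i, x i ^ 2 = ‖x‖ ^ 2 := by
    simp [EuclideanSpace.norm_sq_eq]
  have h1 (i : Fin n) : partialDeriv i (fun y : 𝔼 => k (Real.log (‖y‖ ^ 2))) =ᶠ[𝓝 x]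
      fun y => deriv k (Real.log (‖y‖ ^ 2)) * (2 * y i * (‖y‖ ^ 2)⁻¹) := by
    filter_upwards [isOpen_ne.mem_nhds hx] with y hy
    rw [(hasLineDerivAt_comp_log_norm_sq (hk.differentiable (by simp)) i hy).partialDeriv_eq
      (hψ.differentiable (by simp) y), div_eq_mul_inv]
  have h2 (i : Fin n) : partialDeriv i (partialDeriv i fun y : 𝔼 => k (Real.log (‖y‖ ^ 2))) x =
      4 * (deriv (deriv k) (Real.log (‖x‖ ^ 2)) - deriv k (Real.log (‖x‖ ^ 2)))
          / (‖x‖ ^ 2) ^ 2 * x i ^ 2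
        + 2 * deriv k (Real.log (‖x‖ ^ 2)) / ‖x‖ ^ 2 := by
    have hq := hasLineDerivAt_inv_norm_sq i hx
    have hd : HasLineDerivAt ℝ
        (fun y : 𝔼 => deriv k (Real.log (‖y‖ ^ 2)) * (2 * y i * (‖y‖ ^ 2)⁻¹)) _ x
        (EuclideanSpace.single i 1) := HasDerivAt.mul
      (hasLineDerivAt_comp_log_norm_sq (hk'.differentiable (by simp)) i hx)
      (HasDerivAt.mul (HasDerivAt.const_mul (2 : ℝ) (hasLineDerivAt_coord x i)) hq)
    rw [(hd.congr_of_eventuallyEq (h1 i)).partialDeriv_eq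
      ((contDiff_partialDeriv i hψ).differentiable (by simp) x)]
    simp only [zero_smul, add_zero]
    field_simp
    ring
  rw [lap_eq_sum_partialDeriv hψ]
  simp only [h2, Finset.sum_add_distrib, ← Finset.mul_sum, hsum]
  simp only [Finset.sum_const, Finset.card_univ, Fintype.card_fin, nsmul_eq_mul]
  field_simp
  ring

theorem exists_integral_comp_log_norm_sq_eq (hn : 1 ≤ n) :
    ∃ C : ℝ, 0 < C ∧ ∀ H : ℝ → ℝ,
      ∫ x : 𝔼, (‖x‖ ^ n)⁻¹ * H (Real.log (‖x‖ ^ 2)) = C * ∫ t, H t := by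
  have : Nonempty (Fin n) := ⟨⟨0, by omega⟩⟩
  refine ⟨n * (volume : Measure 𝔼).real (ball 0 1) * 2⁻¹, ?_, fun H => ?_⟩
  · have : 0 < (volume : Measure 𝔼).real (ball 0 1) :=
      ENNReal.toReal_pos (measure_ball_pos _ _ one_pos).ne' measure_ball_lt_top.ne
    have : (0 : ℝ) < n := by exact_mod_cast hn
    positivity
  · have himg : (fun t : ℝ => Real.exp (t / 2)) '' univ = Ioi 0 := by
      ext y
      simp only [image_univ, mem_range, mem_Ioi]
      exact ⟨by rintro ⟨t, rfl⟩; positivity,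
        fun hy => ⟨2 * Real.log y, by rw [mul_div_cancel_left₀ _ two_ne_zero, Real.exp_log hy]⟩⟩
    have hder (t : ℝ) : HasDerivAt (fun t : ℝ => Real.exp (t / 2)) (Real.exp (t / 2) * (1 / 2)) t :=
      ((hasDerivAt_id t).div_const 2).exp
    have hinj : InjOn (fun t : ℝ => Real.exp (t / 2)) univ := fun s _ t _ h => by
      have := Real.exp_injective h
      linarith
    rw [integral_fun_norm_addHaar (volume : Measure 𝔼)
      (fun r => (r ^ n)⁻¹ * H (Real.log (r ^ 2))), ← himg,
      integral_image_eq_integral_abs_deriv_smul MeasurableSet.univ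
        (fun t _ => (hder t).hasDerivWithinAt) hinj]
    have hpt (t : ℝ) : |Real.exp (t / 2) * (1 / 2)| • (Real.exp (t / 2) ^ (n - 1)
        • ((Real.exp (t / 2) ^ n)⁻¹ * H (Real.log (Real.exp (t / 2) ^ 2)))) = 2⁻¹ * H t := by
      have hpow : Real.exp (t / 2) ^ n = Real.exp (t / 2) * Real.exp (t / 2) ^ (n - 1) := by
        rw [← pow_succ', Nat.sub_add_cancel hn]
      have hlog : Real.log (Real.exp (t / 2) ^ 2) = t := by
        rw [Real.log_pow, Real.log_exp]
        push_cast
        ring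
      rw [hlog, hpow, abs_of_pos (by positivity), smul_eq_mul, smul_eq_mul]
      field_simp
    simp only [finrank_euclideanSpace, Fintype.card_fin, hpt, setIntegral_univ,
      integral_const_mul, nsmul_eq_mul]
    rw [smul_eq_mul]
    ring

theorem comp_log_norm_sq_support {k : ℝ → ℝ} {M : ℝ} (hk : ∀ t, t ∉ Ioo 0 M → k t = 0) :
    tsupport (fun y : 𝔼 => k (Real.log (‖y‖ ^ 2))) ⊆ {y | 1 ≤ ‖y‖ ^ 2 ∧ ‖y‖ ^ 2 ≤ Real.exp M} := by
  refine closure_minimal (fun y hy => ?_)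
    ((isClosed_le continuous_const (continuous_norm.pow 2)).inter
      (isClosed_le (continuous_norm.pow 2) continuous_const))
  have ht : Real.log (‖y‖ ^ 2) ∈ Ioo 0 M := by
    by_contra h
    exact hy (hk _ h)
  have hy0 : 0 < ‖y‖ ^ 2 := by
    refine lt_of_le_of_ne (by positivity) fun h => ?_
    rw [← h, Real.log_zero] at ht
    exact lt_irrefl _ ht.1
  exact ⟨((Real.log_pos_iff hy0.le).1 ht.1).le, (Real.log_le_iff_le_exp hy0).1 ht.2.le⟩

theorem tsupport_comp_log_norm_sq_subset {k : ℝ → ℝ} {M : ℝ} (hk : ∀ t, t ∉ Ioo 0 M → k t = 0) :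
    tsupport (fun y : 𝔼 => k (Real.log (‖y‖ ^ 2))) ⊆ ({0}ᶜ : Set 𝔼) := by
  intro y hy h0
  have := (comp_log_norm_sq_support hk hy).1
  rw [mem_singleton_iff.1 h0] at this
  norm_num at this

theorem hasCompactSupport_comp_log_norm_sq {k : ℝ → ℝ} {M : ℝ}
    (hk : ∀ t, t ∉ Ioo 0 M → k t = 0) :
    HasCompactSupport (fun y : 𝔼 => k (Real.log (‖y‖ ^ 2))) := by
  refine (isCompact_closedBall (0 : 𝔼) (√(Real.exp M))).of_isClosed_subset
    (isClosed_tsupport _) fun y hy => ?_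
  simpa using Real.le_sqrt_of_sq_le (comp_log_norm_sq_support hk hy).2

theorem contDiff_comp_log_norm_sq {k : ℝ → ℝ} {M : ℝ} (hsm : ContDiff ℝ (⊤ : ℕ∞) k)
    (hk : ∀ t, t ∉ Ioo 0 M → k t = 0) :
    ContDiff ℝ (⊤ : ℕ∞) (fun y : 𝔼 => k (Real.log (‖y‖ ^ 2))) := by
  refine contDiff_of_contDiffAt_tsupport_s11 fun x hx => ?_
  have hx0 : ‖x‖ ^ 2 ≠ 0 := by simpa using tsupport_comp_log_norm_sq_subset hk hx
  exact hsm.contDiffAt.comp x ((contDiff_norm_sq ℝ).contDiffAt.log hx0)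

theorem exp_mul_log_norm_sq {r : ℝ} (hr : 0 < r) :
    Real.exp (-((n : ℝ) - 4) / 4 * Real.log (r ^ 2)) ^ 2 = r ^ 4 * (r ^ n)⁻¹ := by
  rw [← Real.exp_nat_mul, Real.log_pow]
  have : ((2 : ℕ) : ℝ) * (-((n : ℝ) - 4) / 4 * ((2 : ℕ) * Real.log r)) =
      (4 : ℕ) * Real.log r - n * Real.log r := by
    push_cast
    ring
  rw [this, Real.exp_sub, Real.exp_nat_mul, Real.exp_nat_mul, Real.exp_log hr, div_eq_mul_inv]

theorem deriv_exp_mul_comp_mul {g : ℝ → ℝ} (hg : Differentiable ℝ g) (α ε : ℝ) :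
    deriv (fun t => Real.exp (α * t) * g (ε * t)) =
      fun t => Real.exp (α * t) * (α * g (ε * t) + ε * deriv g (ε * t)) := by
  ext t
  have h1 : HasDerivAt (fun t => Real.exp (α * t)) (Real.exp (α * t) * (α * 1)) t :=
    ((hasDerivAt_id t).const_mul α).exp
  have h2 : HasDerivAt (fun t => g (ε * t)) (deriv g (ε * t) * (ε * 1)) t :=
    (hg (ε * t)).hasDerivAt.comp t ((hasDerivAt_id t).const_mul ε)
  rw [(h1.fun_mul h2).deriv]
  ring

theorem deriv_deriv_exp_mul_comp_mul {g : ℝ → ℝ} (hg : ContDiff ℝ (⊤ : ℕ∞) g) (α ε t : ℝ) :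
    deriv (deriv fun t => Real.exp (α * t) * g (ε * t)) t =
      Real.exp (α * t) * (α ^ 2 * g (ε * t) + 2 * α * ε * deriv g (ε * t)
        + ε ^ 2 * deriv (deriv g) (ε * t)) := by
  have hd := hg.differentiable (by simp)
  have hd' := (contDiff_infty_iff_deriv.1 hg).2.differentiable (by simp)
  rw [deriv_exp_mul_comp_mul hd,
    deriv_exp_mul_comp_mul (g := fun s => α * g s + ε * deriv g s) (by fun_prop)]
  have h : deriv (fun s => α * g s + ε * deriv g s) (ε * t) =
      α * deriv g (ε * t) + ε * deriv (deriv g) (ε * t) :=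
    (((hd _).hasDerivAt.const_mul α).fun_add ((hd' _).hasDerivAt.const_mul ε)).deriv
  simp only [h]
  ring

/-- Testing a Rellich inequality with `|x|^{-(n-4)/2} g(ε log |x|²)` reduces it to an
inequality in one variable. -/
theorem integral_sq_le_of_rellich {c : ℝ} (hn : 1 ≤ n)
    (h : ∀ ψ : 𝔼 → ℝ, ContDiff ℝ (⊤ : ℕ∞) ψ → HasCompactSupport ψ →
      tsupport ψ ⊆ ({0}ᶜ : Set 𝔼) →
      c * ∫ x, ψ x ^ 2 * ((‖x‖ ^ 2)⁻¹) ^ 2 ≤ ∫ x, lap n ψ x ^ 2)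
    {g : ℝ → ℝ} (hg : ContDiff ℝ (⊤ : ℕ∞) g) {M : ℝ} (hM : ∀ t, t ∉ Ioo 0 M → g t = 0)
    {ε : ℝ} (hε : 0 < ε) :
    c * ∫ t, g t ^ 2 ≤ ∫ t, (4 * ε ^ 2 * deriv (deriv g) t + 4 * ε * deriv g t
      - n * ((n : ℝ) - 4) / 4 * g t) ^ 2 := by
  have : Nonempty (Fin n) := ⟨⟨0, by omega⟩⟩
  set k : ℝ → ℝ := fun t => Real.exp (-((n : ℝ) - 4) / 4 * t) * g (ε * t) with hk
  have hsm : ContDiff ℝ (⊤ : ℕ∞) k := by fun_prop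
  have hk0 : ∀ t, t ∉ Ioo 0 (M / ε) → k t = 0 := fun t ht => by
    have : ε * t ∉ Ioo 0 M := fun hmem =>
      ht ⟨(mul_pos_iff_of_pos_left hε).1 hmem.1, by rw [lt_div_iff₀' hε]; exact hmem.2⟩
    simp [hk, hM _ this]
  have hψ := contDiff_comp_log_norm_sq (n := n) hsm hk0
  set Q : ℝ → ℝ := fun s => (4 * ε ^ 2 * deriv (deriv g) s + 4 * ε * deriv g s
    - n * ((n : ℝ) - 4) / 4 * g s) ^ 2 with hQ
  obtain ⟨C, hC, hCint⟩ := exists_integral_comp_log_norm_sq_eq hn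
  have hae : ∀ᵐ x : 𝔼, x ≠ 0 := compl_mem_ae_iff.2 (measure_singleton (0 : 𝔼))
  have key := h _ hψ (hasCompactSupport_comp_log_norm_sq hk0)
    (tsupport_comp_log_norm_sq_subset hk0)
  have hl : ∫ x : 𝔼, k (Real.log (‖x‖ ^ 2)) ^ 2 * ((‖x‖ ^ 2)⁻¹) ^ 2 =
      C * ∫ t, g (ε * t) ^ 2 := by
    rw [← hCint fun t => g (ε * t) ^ 2]
    refine integral_congr_ae ?_
    filter_upwards [hae] with x hx
    have hr : 0 < ‖x‖ := norm_pos_iff.2 hx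
    simp only [hk, mul_pow, exp_mul_log_norm_sq hr]
    field_simp
  have hr : ∫ x : 𝔼, lap n (fun y => k (Real.log (‖y‖ ^ 2))) x ^ 2 =
      C * ∫ t, Q (ε * t) := by
    rw [← hCint fun t => Q (ε * t)]
    refine integral_congr_ae ?_
    filter_upwards [hae] with x hx
    have hr : 0 < ‖x‖ := norm_pos_iff.2 hx
    have hexp := exp_mul_log_norm_sq (n := n) hr
    rw [lap_comp_log_norm_sq hsm hψ hx, deriv_deriv_exp_mul_comp_mul hg,
      deriv_exp_mul_comp_mul (hg.differentiable (by simp))]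
    set t := Real.log (‖x‖ ^ 2)
    calc _ = Real.exp (-((n : ℝ) - 4) / 4 * t) ^ 2 * (4 * ε ^ 2 * deriv (deriv g) (ε * t)
        + 4 * ε * deriv g (ε * t) - n * ((n : ℝ) - 4) / 4 * g (ε * t)) ^ 2 / ‖x‖ ^ 4 := by
          field_simp
          ring
      _ = _ := by
          rw [hexp]
          simp only [hQ]
          field_simp
  rw [hl, hr, Measure.integral_comp_mul_left Q, Measure.integral_comp_mul_left (fun s => g s ^ 2),
    smul_eq_mul, smul_eq_mul, abs_of_pos (inv_pos.2 hε), ← mul_assoc C, ← mul_assoc C,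
    mul_left_comm] at key
  exact le_of_mul_le_mul_left key (by positivity)

/-- The constant in Rellich's inequality is optimal. -/
theorem rellich_constant_optimal {c : ℝ} (hn : 1 ≤ n)
    (h : ∀ ψ : 𝔼 → ℝ, ContDiff ℝ (⊤ : ℕ∞) ψ → HasCompactSupport ψ →
      tsupport ψ ⊆ ({0}ᶜ : Set 𝔼) →
      c * ∫ x, ψ x ^ 2 * ((‖x‖ ^ 2)⁻¹) ^ 2 ≤ ∫ x, lap n ψ x ^ 2) :
    c ≤ (n : ℝ) ^ 2 * ((n : ℝ) - 4) ^ 2 / 16 := by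
  let g : ContDiffBump (2 : ℝ) := ⟨1 / 2, 1, by norm_num, by norm_num⟩
  have hg : ContDiff ℝ (⊤ : ℕ∞) g := g.contDiff
  have hM : ∀ t, t ∉ Ioo (0 : ℝ) 3 → g t = 0 := fun t ht => by
    refine g.zero_of_le_dist ?_
    contrapose! ht
    have := abs_lt.1 (Real.dist_eq t 2 ▸ ht)
    exact ⟨by linarith, by linarith⟩
  have hg' : ContDiff ℝ (⊤ : ℕ∞) (deriv g) := (contDiff_infty_iff_deriv.1 hg).2
  have hg'' : ContDiff ℝ (⊤ : ℕ∞) (deriv (deriv g)) := (contDiff_infty_iff_deriv.1 hg').2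
  have hpos : 0 < ∫ t, g t ^ 2 := by
    refine Continuous.integral_pos_of_hasCompactSupport_nonneg_nonzero (x := 2)
      (g.continuous.pow 2) ?_ (fun t => sq_nonneg _) ?_
    · exact g.hasCompactSupport.mono fun t ht => by
        contrapose! ht
        simp only [Function.mem_support, not_not] at ht ⊢
        simp [ht]
    · simp [g.one_of_mem_closedBall (mem_closedBall_self g.rIn_pos.le)]
  set F : ℝ → ℝ → ℝ := fun ε t => (4 * ε ^ 2 * deriv (deriv g) t + 4 * ε * deriv g t
      - n * ((n : ℝ) - 4) / 4 * g t) ^ 2 with hF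
  have hcont : Continuous fun ε => ∫ t, F ε t := by
    have : Continuous F.uncurry := by
      have h0 := hg.continuous
      have h1 := hg'.continuous
      have h2 := hg''.continuous
      simp only [hF, Function.uncurry_def]
      fun_prop
    convert continuous_parametric_integral_of_continuous (μ := volume) this g.hasCompactSupport
      using 2 with ε
    refine (setIntegral_eq_integral_of_forall_compl_eq_zero fun t ht => ?_).symm
    have h1 : t ∉ tsupport (deriv g) := fun h => ht (tsupport_deriv_subset h)
    have h2 : t ∉ tsupport (deriv (deriv g)) := fun h => h1 (tsupport_deriv_subset h)
    simp [hF, image_eq_zero_of_notMem_tsupport ht, image_eq_zero_of_notMem_tsupport h1,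
      image_eq_zero_of_notMem_tsupport h2]
  have hlim : c * ∫ t, g t ^ 2 ≤ ∫ t, F 0 t :=
    ge_of_tendsto ((hcont.tendsto 0).mono_left nhdsWithin_le_nhds)
      (eventually_mem_nhdsWithin.mono fun ε (hε : ε ∈ Ioi (0 : ℝ)) =>
        integral_sq_le_of_rellich hn h hg hM hε)
  have hF0 : ∫ t, F 0 t = (n : ℝ) ^ 2 * ((n : ℝ) - 4) ^ 2 / 16 * ∫ t, g t ^ 2 := by
    rw [← integral_const_mul]
    refine integral_congr_ae (Eventually.of_forall fun t => ?_)
    simp only [hF]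
    ring
  exact le_of_mul_le_mul_right (hlim.trans_eq hF0) hpos

end Sharpness

theorem ell2_pos {n : ℕ} {a p : ℝ} (ha : 0 ≤ a) (hp : 1 < p)
    (hβ : (4 + a) / (p - 1) < (n : ℝ) - 4) : 0 < ell2 n a p := by
  have hb : 0 < (4 + a) / (p - 1) := div_pos (by linarith) (by linarith)
  simp only [ell2]
  generalize (4 + a) / (p - 1) = β at *
  have h1 : 0 < (n : ℝ) - 4 - β := by linarith
  have h2 : 0 < (n : ℝ) - 2 - β := by linarith
  positivity

/-- The potential `|x|^a u_s^{p-1}` of the singular solution is `ℓ₂ |x|⁻⁴`. -/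
theorem singular_potential_eq {l r a p : ℝ} (hl : 0 < l) (hr : 0 < r) (hp : 1 < p) :
    r ^ a * (l ^ (1 / (p - 1)) * r ^ (-((4 + a) / (p - 1)))) ^ (p - 1) = l * ((r ^ 2)⁻¹) ^ 2 := by
  have hp' : p - 1 ≠ 0 := by linarith
  rw [Real.mul_rpow (by positivity) (by positivity), ← Real.rpow_mul hl.le, ← Real.rpow_mul hr.le,
    one_div, inv_mul_cancel₀ hp', Real.rpow_one, mul_left_comm, ← Real.rpow_add hr]
  have : a + -((4 + a) / (p - 1)) * (p - 1) = -(4 : ℕ) := by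
    field_simp
    push_cast
    ring
  rw [this, Real.rpow_neg hr.le, Real.rpow_natCast, inv_pow, ← pow_mul]

/-- the singular solution `u_s` is stable on `ℝⁿ \ {0}` if and only if
`p ℓ₂ ≤ n²(n-4)²/16` (via the Hardy–Rellich inequality). -/
theorem stmt11 (n : ℕ) (hn : 5 ≤ n) (a p : ℝ) (ha : 0 ≤ a) (hp : 1 < p)
    (hβ : (4 + a) / (p - 1) < (n : ℝ) - 4) :
    ((∀ ψ : EuclideanSpace ℝ (Fin n) → ℝ, ContDiff ℝ (⊤ : ℕ∞) ψ → HasCompactSupport ψ →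
        tsupport ψ ⊆ ({0}ᶜ : Set (EuclideanSpace ℝ (Fin n))) →
        p * ∫ x, ‖x‖ ^ a *
            (ell2 n a p ^ (1 / (p - 1)) * ‖x‖ ^ (-((4 + a) / (p - 1)))) ^ (p - 1) *
            ψ x ^ 2 ≤
          ∫ x, lap n ψ x ^ 2) ↔
      p * ell2 n a p ≤ (n : ℝ) ^ 2 * ((n : ℝ) - 4) ^ 2 / 16) := by
  have hiff (ψ : EuclideanSpace ℝ (Fin n) → ℝ)
      (h0 : tsupport ψ ⊆ ({0}ᶜ : Set (EuclideanSpace ℝ (Fin n)))) :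
      p * ∫ x, ‖x‖ ^ a *
          (ell2 n a p ^ (1 / (p - 1)) * ‖x‖ ^ (-((4 + a) / (p - 1)))) ^ (p - 1) * ψ x ^ 2 =
        p * ell2 n a p * ∫ x, ψ x ^ 2 * ((‖x‖ ^ 2)⁻¹) ^ 2 := by
    rw [mul_assoc, ← integral_const_mul (ell2 n a p)]
    congr 1
    refine integral_congr_ae (Eventually.of_forall fun x => ?_)
    rcases eq_or_ne x 0 with rfl | hx
    · have : ψ 0 = 0 := image_eq_zero_of_notMem_tsupport fun h => h0 h rfl
      simp [this]
    · beta_reduce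
      rw [singular_potential_eq (ell2_pos ha hp hβ) (norm_pos_iff.2 hx) hp]
      ring
  constructor
  · intro h
    exact rellich_constant_optimal (n := n) (by omega) fun ψ hψ hc h0 =>
      (hiff ψ h0).symm.trans_le (h ψ hψ hc h0)
  · intro h ψ hψ hc h0
    rw [hiff ψ h0]
    refine le_trans (mul_le_mul_of_nonneg_right h ?_) (rellich_inequality (by omega) hψ hc h0)
    exact integral_nonneg fun x => by positivity
end
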